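/- Let ν be a probability measure on ℤ^m satisfying (C1)-(C4). Then the positive harmonic functions of the substochastic kernel P_+ = (ν(u'−u), u, u' ∈ ℤ_+^m) are exactly the constant multiples of the function f(u) = Π_{i=1}^m u^i − E_u(Π_{i=1}^m ξ^i(min_{1≤j≤m} τ_j)), u ∈ ℤ_+^m. -/

import Mathlib

open Filter Topology

attribute [local instance] Classical.propDecidable

noncomputable section

variable {V : Type*} [AddCommGroup V]

/-- `n`-step transition kernel of the random walk with step distribution `μ`,
killed upon leaving the set `A` : `kern μ A n x y = P_x(S n = y, τ_A > n)`,
where `τ_A` is the first exit time from `A`. -/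
def kern (μ : V → ℝ) (A : Set V) : ℕ → V → V → ℝ
  | 0 => fun x y => if x = y ∧ x ∈ A then 1 else 0
  | n + 1 => fun x y => ∑' z : V, (if x ∈ A then μ (z - x) else 0) * kern μ A n z y

/-- Green function of the walk killed outside `A`. -/
def green (μ : V → ℝ) (A : Set V) (x y : V) : ℝ :=
  ∑' n : ℕ, kern μ A n x y

/-- `E_x [ g(S τ) ; S τ ∈ B, τ < ∞ ]`, where `τ` is the first exit time from `A`. -/
def exitExp (μ : V → ℝ) (A B : Set V) (g : V → ℝ) (x : V) : ℝ :=
  ∑' n : ℕ, ∑' z : V, kern μ A n x z *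
    ∑' y : V, (if y ∉ A ∧ y ∈ B then μ (y - z) else 0) * g y

/-- `ℝ≥0∞`-valued version of `exitExp`. -/
def exitExpE (μ : V → ℝ) (A B : Set V) (g : V → ℝ) (x : V) : ENNReal :=
  ∑' n : ℕ, ∑' z : V, ENNReal.ofReal (kern μ A n x z) *
    ∑' y : V, ENNReal.ofReal ((if y ∉ A ∧ y ∈ B then μ (y - z) else 0) * g y)

/-- `P_x(S t = y for some t ≥ 0)` for the walk killed outside `A`
(first passage decomposition). -/
def hitProb (μ : V → ℝ) (A : Set V) (x y : V) : ℝ :=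
  (if x = y ∧ x ∈ A then 1 else 0) +
    ∑' n : ℕ, ∑' z : V, kern μ (A \ {y}) n x z * (if y ∈ A then μ (y - z) else 0)

/-- `h` is (strictly speaking, satisfies the mean value property of a) harmonic
function on `A` for the walk with step distribution `μ` killed outside `A`. -/
def HarmOn (μ : V → ℝ) (A : Set V) (h : V → ℝ) : Prop :=
  ∀ x ∈ A, h x = ∑' y : V, if y ∈ A then μ (y - x) * h y else 0

/-- Irreducibility of the walk killed outside `A`. -/
def Irred (μ : V → ℝ) (A : Set V) : Prop :=
  ∀ x ∈ A, ∀ x' ∈ A, ∃ (k : ℕ) (c : ℕ → V), c 0 = x ∧ c k = x' ∧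
    (∀ j ≤ k, c j ∈ A) ∧ ∀ j < k, 0 < μ (c (j + 1) - c j)

/-- A sequence `xs` is fundamental for the walk killed outside `A` :
the Martin kernels `G(x, xs n)/G(x₀, xs n)` converge for every `x ∈ A`. -/
def Fundamental (μ : V → ℝ) (A : Set V) (x₀ : V) (xs : ℕ → V) : Prop :=
  ∀ x ∈ A, ∃ L : ℝ,
    Tendsto (fun n => green μ A x (xs n) / green μ A x₀ (xs n)) atTop (𝓝 L)

/-- ℓ¹-norm of an integer vector. -/
def znorm {ι : Type*} [Fintype ι] (x : ι → ℤ) : ℝ := ∑ i, |(x i : ℝ)|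

/-- ℓ¹-norm of a real vector. -/
def rnorm {ι : Type*} [Fintype ι] (q : ι → ℝ) : ℝ := ∑ i, |q i|

variable {d : ℕ}

/-- `ℤ^{Λ,d}_+ = {x ∈ ℤ^d : xⁱ > 0 for all i ∈ Λ}`. -/
def posDom (Λ : Set (Fin d)) : Set (Fin d → ℤ) := {x | ∀ i ∈ Λ, 0 < x i}

/-- `ℤ^d_+ = {x ∈ ℤ^d : xⁱ > 0 for all i}`. -/
def posAll : Set (Fin d → ℤ) := {x | ∀ i, 0 < x i}

/-- `a · z` for `a ∈ ℝ^d`, `z ∈ ℤ^d`. -/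
def dotZ (a : Fin d → ℝ) (z : Fin d → ℤ) : ℝ := ∑ i, a i * (z i : ℝ)

/-- `a · q` for `a, q ∈ ℝ^d`. -/
def dotR (a q : Fin d → ℝ) : ℝ := ∑ i, a i * q i

/-- jump generating function `φ(a) = Σ_z μ(z) exp(a·z)` (valued in `ℝ≥0∞`). -/
def phiE (μ : (Fin d → ℤ) → ℝ) (a : Fin d → ℝ) : ENNReal :=
  ∑' z : Fin d → ℤ, ENNReal.ofReal (μ z * Real.exp (dotZ a z))

/-- `D = {a ∈ ℝ^d : φ(a) ≤ 1}`. -/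
def Dset (μ : (Fin d → ℤ) → ℝ) : Set (Fin d → ℝ) := {a | phiE μ a ≤ 1}

/-- mean vector `M = Σ_z μ(z) z`. -/
def Mvec (μ : (Fin d → ℤ) → ℝ) : Fin d → ℝ := fun i => ∑' z : Fin d → ℤ, μ z * (z i : ℝ)

/-- `Λ(M) = {i : Mⁱ = 0}`. -/
def LambdaM (μ : (Fin d → ℤ) → ℝ) : Set (Fin d) := {i | Mvec μ i = 0}

/-- Assumption (A1) : irreducibility on every `ℤ^{Λ,d}_+`. -/
def A1 (μ : (Fin d → ℤ) → ℝ) : Prop := ∀ Λ : Set (Fin d), Irred μ (posDom Λ)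

/-- Assumption (A2) : `φ` is finite on a neighborhood of the set `D`. -/
def A2 (μ : (Fin d → ℤ) → ℝ) : Prop :=
  ∃ U : Set (Fin d → ℝ), IsOpen U ∧ Dset μ ⊆ U ∧ ∀ a ∈ U, phiE μ a ≠ ⊤

/-- Assumption (A3) : `M ≠ 0`. -/
def A3 (μ : (Fin d → ℤ) → ℝ) : Prop := Mvec μ ≠ 0

/-- projection `x ↦ x^Λ`. -/
def projL (Λ : Set (Fin d)) (x : Fin d → ℤ) : ↥Λ → ℤ := fun i => x (i : Fin d)

/-- jump distribution `μ_Λ(v) = Σ_{x : x^Λ = v} μ(x)` of the projected walk. -/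
def muL (μ : (Fin d → ℤ) → ℝ) (Λ : Set (Fin d)) (v : ↥Λ → ℤ) : ℝ :=
  ∑' x : Fin d → ℤ, if projL Λ x = v then μ x else 0

/-- `ℤ^Λ_+`. -/
def posL (Λ : Set (Fin d)) : Set (↥Λ → ℤ) := {u | ∀ i, 0 < u i}

end

/-- `f(u) = Π_i uⁱ − E_u(Π_i ξⁱ(min_j τ_j))`. -/
noncomputable def fProd {m : ℕ} (ν : (Fin m → ℤ) → ℝ) (u : Fin m → ℤ) : ℝ :=
  (∏ i, (u i : ℝ)) -
    exitExp ν {v : Fin m → ℤ | ∀ i, 0 < v i} Set.univ (fun y => ∏ i, (y i : ℝ)) u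

section MomentArrays

/-- Binomial expansion of a two-parameter array satisfying Pascal's relation. -/
theorem sum_choose_mul_array (n : ℕ) (s : ℕ → ℕ → ℝ)
    (hrec : ∀ j k, s j k = s (j + 1) k + s j (k + 1)) :
    ∑ p ∈ Finset.HasAntidiagonal.antidiagonal n, (n.choose p.1 : ℝ) * s p.1 p.2 = s 0 0 := by
  induction n generalizing s with
  | zero => simp
  | succ n ih =>
    rw [Finset.sum_antidiagonal_choose_succ_mul (fun i j => s i j),
      ← Finset.sum_add_distrib, ← ih s hrec]
    refine Finset.sum_congr rfl fun p hp => ?_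
    rw [hrec p.1 p.2, Nat.choose_symm_of_eq_add (Finset.HasAntidiagonal.mem_antidiagonal.1 hp).symm]
    ring

theorem sum_choose_mul_fst_mul_array (n : ℕ) (s : ℕ → ℕ → ℝ)
    (hrec : ∀ j k, s j k = s (j + 1) k + s j (k + 1)) :
    ∑ p ∈ Finset.HasAntidiagonal.antidiagonal n, (n.choose p.1 : ℝ) * (p.1 * s p.1 p.2) = n * s 1 0 := by
  cases n with
  | zero => simp
  | succ n =>
    rw [Finset.Nat.sum_antidiagonal_succ, ← sum_choose_mul_array n (fun j k => s (j + 1) k)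
      (fun j k => hrec (j + 1) k), Finset.mul_sum]
    simp only [Nat.choose_zero_right, Nat.cast_zero, zero_mul, mul_zero, zero_add]
    refine Finset.sum_congr rfl fun p _ => ?_
    have := congrArg (Nat.cast (R := ℝ)) (Nat.add_one_mul_choose_eq n p.1)
    push_cast at this ⊢
    linear_combination - s (p.1 + 1) p.2 * this

/-- Log-convexity of completely monotone sequences. -/
theorem sq_le_mul_of_array (s : ℕ → ℕ → ℝ) (hs : ∀ j k, 0 ≤ s j k)
    (hrec : ∀ j k, s j k = s (j + 1) k + s j (k + 1)) :
    s 1 0 ^ 2 ≤ s 0 0 * s 2 0 := by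
  have key : ∀ n : ℕ, s 1 0 ^ 2 ≤ s 0 0 * s 2 0 + s 0 0 * s 1 0 * (1 / ((n : ℝ) + 1)) := by
    intro n
    have h0 := sum_choose_mul_array (n + 1) s hrec
    have h1 := sum_choose_mul_fst_mul_array (n + 1) s hrec
    have h2 : ∑ p ∈ Finset.HasAntidiagonal.antidiagonal (n + 1), ((n + 1).choose p.1 : ℝ) * (p.1 ^ 2 * s p.1 p.2)
        = (n + 1) * (n * s 2 0 + s 1 0) := by
      rw [Finset.Nat.sum_antidiagonal_succ,
        ← sum_choose_mul_array n (fun j k => s (j + 1) k) (fun j k => hrec (j + 1) k),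
        ← sum_choose_mul_fst_mul_array n (fun j k => s (j + 1) k) (fun j k => hrec (j + 1) k),
        ← Finset.sum_add_distrib, Finset.mul_sum]
      simp only [Nat.choose_zero_right, Nat.cast_zero, zero_mul, mul_zero, zero_add, ne_eq,
        OfNat.ofNat_ne_zero, not_false_eq_true, zero_pow]
      refine Finset.sum_congr rfl fun p _ => ?_
      have := congrArg (Nat.cast (R := ℝ)) (Nat.add_one_mul_choose_eq n p.1)
      push_cast at this ⊢
      linear_combination - ((p.1 : ℝ) + 1) * s (p.1 + 1) p.2 * this
    have cs := Finset.sum_sq_le_sum_mul_sum_of_sq_le_mul (Finset.HasAntidiagonal.antidiagonal (n + 1))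
      (r := fun p => ((n + 1).choose p.1 : ℝ) * (p.1 * s p.1 p.2))
      (f := fun p => ((n + 1).choose p.1 : ℝ) * s p.1 p.2)
      (g := fun p => ((n + 1).choose p.1 : ℝ) * (p.1 ^ 2 * s p.1 p.2))
      (fun p _ => mul_nonneg (by positivity) (hs _ _))
      (fun p _ => mul_nonneg (by positivity) (mul_nonneg (by positivity) (hs _ _)))
      (fun p _ => le_of_eq (by ring))
    rw [h0, h1, h2] at cs
    have hn : (0 : ℝ) < (n : ℝ) + 1 := by positivity
    have e : s 0 0 * s 2 0 + s 0 0 * s 1 0 * (1 / ((n : ℝ) + 1)) - s 1 0 ^ 2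
      = (((n : ℝ) + 1) ^ 2)⁻¹ * (s 0 0 * (((n : ℝ) + 1) * (((n : ℝ) + 1) * s 2 0 + s 1 0))
          - (((n : ℝ) + 1) * s 1 0) ^ 2) := by
      field_simp
    have : 0 ≤ (((n : ℝ) + 1) ^ 2)⁻¹ * (s 0 0 * (((n : ℝ) + 1) * (((n : ℝ) + 1) * s 2 0 + s 1 0))
          - (((n : ℝ) + 1) * s 1 0) ^ 2) := by
      refine mul_nonneg (by positivity) ?_
      push_cast at cs
      have : 0 ≤ s 0 0 * (((n : ℝ) + 1) * s 2 0) :=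
        mul_nonneg (hs _ _) (mul_nonneg hn.le (hs _ _))
      nlinarith
    linarith
  have lim : Tendsto (fun n : ℕ => s 0 0 * s 2 0 + s 0 0 * s 1 0 * (1 / ((n : ℝ) + 1))) atTop
      (𝓝 (s 0 0 * s 2 0 + s 0 0 * s 1 0 * 0)) :=
    (tendsto_one_div_add_atTop_nhds_zero_nat.const_mul _).const_add _
  simpa using ge_of_tendsto' lim key

theorem pow_mul_le_of_array (s : ℕ → ℕ → ℝ) (hs : ∀ j k, 0 ≤ s j k)
    (hrec : ∀ j k, s j k = s (j + 1) k + s j (k + 1)) (h0 : 0 < s 0 0) (n : ℕ) :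
    (s 1 0 / s 0 0) ^ n * s 0 0 ≤ s n 0 := by
  rcases (hs 1 0).eq_or_lt with h1 | h1
  · cases n with
    | zero => simp
    | succ n => simpa [← h1] using hs (n + 1) 0
  have key : ∀ n, 0 < s n 0 ∧ s 1 0 / s 0 0 * s n 0 ≤ s (n + 1) 0 := by
    intro n
    induction n with
    | zero => exact ⟨h0, by rw [div_mul_cancel₀ _ h0.ne']⟩
    | succ n ih =>
      have hpos : 0 < s (n + 1) 0 := lt_of_lt_of_le (mul_pos (div_pos h1 h0) ih.1) ih.2
      refine ⟨hpos, ?_⟩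
      have lc := sq_le_mul_of_array (fun j k => s (n + j) k) (fun _ _ => hs _ _)
        (fun j k => hrec (n + j) k)
      simp only [add_zero] at lc
      refine le_of_mul_le_mul_left ?_ ih.1
      have := mul_le_mul_of_nonneg_right ih.2 hpos.le
      change _ ≤ s n 0 * s (n + 2) 0
      nlinarith
  induction n with
  | zero => simp
  | succ n ih =>
    refine le_trans ?_ (key n).2
    rw [pow_succ', mul_assoc]
    exact mul_le_mul_of_nonneg_left ih (div_nonneg (hs _ _) (hs _ _))

/-- If the `k`-direction of a positive array with Pascal's relation decays no faster than `q ^ k`,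
uniformly in the other direction, then its first step loses at most a factor `q`. -/
theorem mul_le_of_array (s : ℕ → ℕ → ℝ) (hs : ∀ j k, 0 ≤ s j k)
    (hrec : ∀ j k, s j k = s (j + 1) k + s j (k + 1)) {C q : ℝ} (hC : 0 < C) (hq : 0 ≤ q)
    (hlow : ∀ j k, C * q ^ k * s j 0 ≤ s j k) : q * s 0 0 ≤ s 0 1 := by
  rcases (hs 0 0).eq_or_lt with h0 | h0
  · rw [← h0, mul_zero]; exact hs _ _
  set r := s 1 0 / s 0 0 with hr
  have hr0 : 0 ≤ r := div_nonneg (hs _ _) (hs _ _)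
  have bound : ∀ n : ℕ, (r + q) ^ n ≤ 1 / C := by
    intro n
    have e := sum_choose_mul_array n s hrec
    have : C * (r + q) ^ n * s 0 0 ≤ s 0 0 := by
      conv_rhs => rw [← e]
      rw [(Commute.all r q).add_pow', Finset.mul_sum, Finset.sum_mul]
      refine Finset.sum_le_sum fun p _ => ?_
      have h1 := pow_mul_le_of_array s hs hrec h0 p.1
      have h2 := hlow p.1 p.2
      have h3 : C * q ^ p.2 * (r ^ p.1 * s 0 0) ≤ s p.1 p.2 :=
        (mul_le_mul_of_nonneg_left h1 (by positivity)).trans h2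
      have := mul_le_mul_of_nonneg_left h3 (Nat.cast_nonneg (α := ℝ) (n.choose p.1))
      simp only [nsmul_eq_mul]
      linarith
    rw [le_div_iff₀ hC]
    nlinarith
  have hle : r + q ≤ 1 := by
    by_contra! h
    obtain ⟨n, hn⟩ := pow_unbounded_of_one_lt (1 / C) h
    exact absurd (bound n) (not_le.2 hn)
  have : r * s 0 0 = s 1 0 := by rw [hr, div_mul_cancel₀ _ h0.ne']
  have := hrec 0 0
  simp only [zero_add] at this
  nlinarith

end MomentArrays

section HalfLine

/-- A finite, nondegenerate, centered law on `ℤ` with an exponential moment of order `2 θ`. -/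
structure CenteredLaw (μ : ℤ → ℝ) (θ : ℝ) : Prop where
  theta_pos : 0 < θ
  nonneg : ∀ k, 0 ≤ μ k
  mean : HasSum (fun k : ℤ => μ k * (k : ℝ)) 0
  exp_moment : Summable fun k : ℤ => μ k * Real.exp (2 * θ * |(k : ℝ)|)
  nondegenerate : ∃ k : ℤ, k ≠ 0 ∧ 0 < μ k

namespace CenteredLaw

variable {μ : ℤ → ℝ} {θ : ℝ}

theorem summable_mul (hμ : CenteredLaw μ θ) {f : ℤ → ℝ} (C : ℝ)
    (hf : ∀ k : ℤ, |f k| ≤ C * Real.exp (2 * θ * |(k : ℝ)|)) : Summable fun k => μ k * f k := by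
  refine Summable.of_norm_bounded (hμ.exp_moment.mul_left C) fun k => ?_
  rw [Real.norm_eq_abs, abs_mul, abs_of_nonneg (hμ.nonneg k)]
  have := mul_le_mul_of_nonneg_left (hf k) (hμ.nonneg k)
  linarith

theorem summable (hμ : CenteredLaw μ θ) : Summable μ := by
  have := hμ.summable_mul (f := fun _ => 1) 1 fun k => by
    have := Real.one_le_exp (x := 2 * θ * |(k : ℝ)|)
      (mul_nonneg (by linarith [hμ.theta_pos]) (abs_nonneg _))
    simpa using this
  simpa using this

theorem tsum_pos (hμ : CenteredLaw μ θ) : 0 < ∑' k, μ k := by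
  obtain ⟨k, -, hk⟩ := hμ.nondegenerate
  exact hμ.summable.tsum_pos hμ.nonneg k hk

theorem neg (hμ : CenteredLaw μ θ) : CenteredLaw (fun k => μ (-k)) θ where
  theta_pos := hμ.theta_pos
  nonneg k := hμ.nonneg _
  mean := by
    have := ((Equiv.neg ℤ).hasSum_iff.2 hμ.mean).neg
    simpa [Function.comp_def] using this
  exp_moment := by
    have := (Equiv.neg ℤ).summable_iff.2 hμ.exp_moment
    simpa [Function.comp_def] using this
  nondegenerate := by
    obtain ⟨k, h0, hk⟩ := hμ.nondegenerate
    exact ⟨-k, by simpa using h0, by simpa using hk⟩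

theorem exists_pos_step (hμ : CenteredLaw μ θ) : ∃ k : ℤ, 0 < k ∧ 0 < μ k := by
  by_contra! h
  obtain ⟨k, h0, hk⟩ := hμ.nondegenerate
  have hk0 : k < 0 := lt_of_le_of_ne (not_lt.1 fun h' => absurd hk (not_lt.2 (h k h'))) h0
  have hnp : ∀ n : ℤ, 0 ≤ -(μ n * n) := by
    intro n
    rcases le_or_gt n 0 with hn | hn
    · have : (n : ℝ) ≤ 0 := by exact_mod_cast hn
      nlinarith [hμ.nonneg n]
    · rw [le_antisymm (h n hn) (hμ.nonneg n)]; simp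
  have hs : HasSum (fun n : ℤ => -(μ n * n)) 0 := by simpa using hμ.mean.neg
  have := congrFun ((hasSum_zero_iff_of_nonneg hnp).1 hs) k
  have hk' : (k : ℝ) < 0 := by exact_mod_cast hk0
  simp only [Pi.zero_apply, neg_eq_zero] at this
  nlinarith [mul_neg_of_pos_of_neg hk hk']

theorem summable_exp (hμ : CenteredLaw μ θ) {s : ℝ} (hs : |s| ≤ 2 * θ) :
    Summable fun k : ℤ => μ k * Real.exp (s * k) := by
  refine hμ.summable_mul 1 fun k => ?_
  rw [abs_of_pos (Real.exp_pos _), one_mul]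
  refine Real.exp_le_exp.2 ((le_abs_self _).trans ?_)
  rw [abs_mul]
  exact mul_le_mul_of_nonneg_right hs (abs_nonneg _)

theorem exists_exp_gap (hμ : CenteredLaw μ θ) :
    ∃ δ : ℝ, 0 < δ ∧ HasSum (fun k : ℤ => μ k * (Real.exp (θ * k) - 1)) δ := by
  have hs : Summable fun k : ℤ => μ k * (Real.exp (θ * k) - 1 - θ * k) := by
    have := ((hμ.summable_exp (s := θ) (by rw [abs_of_pos hμ.theta_pos]; linarith [hμ.theta_pos])).sub
      hμ.summable).sub (hμ.mean.summable.mul_left θ)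
    refine this.congr fun k => by ring
  have hnn : ∀ k : ℤ, 0 ≤ μ k * (Real.exp (θ * k) - 1 - θ * k) := fun k =>
    mul_nonneg (hμ.nonneg k) (by linarith [Real.add_one_le_exp (θ * k)])
  obtain ⟨k, h0, hk⟩ := hμ.nondegenerate
  refine ⟨∑' k : ℤ, μ k * (Real.exp (θ * k) - 1 - θ * k), hs.tsum_pos hnn k ?_, ?_⟩
  · refine mul_pos hk ?_
    have := Real.add_one_lt_exp (x := θ * k)
      (mul_ne_zero hμ.theta_pos.ne' (by exact_mod_cast h0))
    linarith
  · have := hs.hasSum.add (hμ.mean.mul_left θ)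
    rw [mul_zero, add_zero] at this
    refine this.congr_fun ?_
    intro k; ring

/-- Far from the origin, the convexity gain of `exp (-θ x)` beats any multiple of the mass that
the law puts beyond the origin. -/
theorem exists_exp_correction (hμ : CenteredLaw μ θ) (C : ℝ) :
    ∃ K : ℤ, 0 < K ∧ ∀ x : ℤ, K ≤ x → ∃ d : ℝ, 0 ≤ d ∧
      HasSum (fun k : ℤ => μ k * (Real.exp (-θ * (x - k)) - Real.exp (-θ * x)
        - C * Real.exp (-2 * θ * (x - k)))) d := by
  obtain ⟨δ, hδ, hsum⟩ := hμ.exists_exp_gap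
  have hM := (hμ.summable_exp (s := 2 * θ)
    (by rw [abs_of_pos (by linarith [hμ.theta_pos])])).hasSum
  set M := ∑' k : ℤ, μ k * Real.exp (2 * θ * k) with hMdef
  have hsmall : ∃ K : ℤ, 0 < K ∧ ∀ x : ℤ, K ≤ x → C * M * Real.exp (-θ * x) ≤ δ := by
    have h1 : Tendsto (fun x : ℤ => C * M * Real.exp (-θ * (x : ℝ))) atTop (𝓝 (C * M * 0)) := by
      refine Tendsto.const_mul _ (Real.tendsto_exp_atBot.comp ?_)
      exact (tendsto_intCast_atTop_atTop).const_mul_atTop_of_neg (by linarith [hμ.theta_pos])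
    rw [mul_zero] at h1
    obtain ⟨K, hK⟩ := (h1.eventually (eventually_le_nhds hδ)).exists_forall_of_atTop
    exact ⟨max K 1, by simp, fun x hx => hK x ((le_max_left _ _).trans hx)⟩
  obtain ⟨K, hK0, hK⟩ := hsmall
  refine ⟨K, hK0, fun x hx => ⟨Real.exp (-θ * x) * δ - C * Real.exp (-2 * θ * x) * M, ?_, ?_⟩⟩
  · have e : Real.exp (-2 * θ * x) = Real.exp (-θ * x) * Real.exp (-θ * x) := by
      rw [← Real.exp_add]; ring_nf
    have := mul_le_mul_of_nonneg_left (hK x hx) (Real.exp_pos (-θ * x)).le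
    rw [e]; nlinarith
  · refine ((hsum.mul_left (Real.exp (-θ * x))).sub
      (hM.mul_left (C * Real.exp (-2 * θ * x)))).congr_fun ?_
    intro k
    have e1 : Real.exp (-θ * (x - k)) = Real.exp (-θ * x) * Real.exp (θ * k) := by
      rw [← Real.exp_add]; ring_nf
    have e2 : Real.exp (-2 * θ * (x - k)) = Real.exp (-2 * θ * x) * Real.exp (2 * θ * k) := by
      rw [← Real.exp_add]; ring_nf
    rw [e1, e2]; ring

end CenteredLaw

/-- Nonnegative functions on `ℤ`, vanishing on the nonpositive integers and satisfying the mean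
value property on the positive ones. -/
structure HalfLineHarmonic (μ : ℤ → ℝ) (h : ℤ → ℝ) : Prop where
  nonneg : ∀ x, 0 ≤ h x
  eq_zero : ∀ x, x ≤ 0 → h x = 0
  hasSum : ∀ x, 0 < x → HasSum (fun y => μ (y - x) * h y) ((∑' k, μ k) * h x)

theorem hasSum_mul_sub_of_finset (μ w : ℤ → ℝ) (s : Finset ℤ) (hw : ∀ x, x ∉ s → w x = 0) (y : ℤ) :
    HasSum (fun k => μ k * w (y - k)) (∑ x ∈ s, μ (y - x) * w x) := by
  have h := hasSum_sum_of_ne_finset_zero (L := .unconditional ℤ) (f := fun x => μ (y - x) * w x) (s := s)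
    (fun x hx => by simp [hw x hx])
  rw [← (Equiv.subLeft y).hasSum_iff] at h
  refine h.congr_fun ?_
  intro k
  simp

/-- Summation by parts against a finitely supported test function. -/
theorem HalfLineHarmonic.hasSum_duality {μ h : ℤ → ℝ} (hh : HalfLineHarmonic μ h) (w : ℤ → ℝ)
    (s : Finset ℤ) (hs : ∀ x ∈ s, 0 < x) (hw : ∀ x, x ∉ s → w x = 0) :
    HasSum (fun y => (∑ x ∈ s, μ (y - x) * w x - (∑' k, μ k) * w y) * h y) 0 := by
  have h1 : HasSum (fun y => ∑ x ∈ s, w x * (μ (y - x) * h y))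
      (∑ x ∈ s, w x * ((∑' k, μ k) * h x)) :=
    hasSum_sum fun x hx => (hh.hasSum x (hs x hx)).mul_left (w x)
  have h2 := hasSum_sum_of_ne_finset_zero (L := .unconditional ℤ) (f := fun x => w x * ((∑' k, μ k) * h x)) (s := s)
    (fun x hx => by simp [hw x hx])
  have h3 := h1.sub h2
  rw [sub_self] at h3
  refine h3.congr_fun ?_
  intro y
  rw [sub_mul, Finset.sum_mul]
  congr 1
  · exact Finset.sum_congr rfl fun x _ => by ring
  · ring

end HalfLine

section HalfLineUniqueness

variable {μ : ℤ → ℝ} {θ : ℝ} {h : ℤ → ℝ}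

theorem exp_tent_le (hθ : 0 < θ) {N : ℝ} (hN : 1 ≤ N) {z : ℝ} (hz : z ≤ 0) :
    (N - z) + N * (Real.exp (-θ * z) - Real.exp (-θ * N))
      ≤ N * ((2 + 1 / θ) * Real.exp (-2 * θ * z)) := by
  have h1 : 1 ≤ Real.exp (-θ * z) := Real.one_le_exp (by nlinarith)
  have e : Real.exp (-2 * θ * z) = Real.exp (-θ * z) * Real.exp (-θ * z) := by
    rw [← Real.exp_add]; ring_nf
  have h2 : Real.exp (-θ * z) ≤ Real.exp (-2 * θ * z) := by rw [e]; nlinarith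
  have h3 : -z ≤ 1 / θ * Real.exp (-2 * θ * z) := by
    rw [one_div, ← div_eq_inv_mul, le_div_iff₀ hθ]
    have := Real.add_one_le_exp (-θ * z)
    nlinarith
  have h4 := Real.exp_pos (-θ * N)
  have h5 : -z ≤ N * (1 / θ * Real.exp (-2 * θ * z)) := by
    have : 0 ≤ 1 / θ * Real.exp (-2 * θ * z) := by positivity
    nlinarith
  have h6 : N * Real.exp (-θ * z) ≤ N * Real.exp (-2 * θ * z) := by nlinarith
  have h7 : N ≤ N * Real.exp (-2 * θ * z) := by nlinarith
  nlinarith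

/-- Harmonic functions on the half-line grow at most linearly. -/
theorem HalfLineHarmonic.exists_le_mul (hμ : CenteredLaw μ θ) (hh : HalfLineHarmonic μ h) :
    ∃ C : ℝ, 0 < C ∧ ∀ x : ℤ, 0 < x → h x ≤ C * x := by
  obtain ⟨j, hj, hμj⟩ := hμ.exists_pos_step
  obtain ⟨K, hK0, hK⟩ := hμ.exists_exp_correction (2 + 1 / θ)
  have hp := hμ.tsum_pos
  set p := ∑' k, μ k with hpdef
  set S := ∑ y ∈ Finset.Icc 1 K, h y with hS
  have hθ := hμ.theta_pos
  have hS0 : 0 ≤ S := Finset.sum_nonneg fun y _ => hh.nonneg y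
  have hjR : (0 : ℝ) < j := by exact_mod_cast hj
  have main : ∀ N : ℤ, j < N → μ j * j * h N ≤ 2 * N * p * S := by
    intro N hN
    have hN1 : (1 : ℝ) ≤ N := by exact_mod_cast (by omega : (1 : ℤ) ≤ N)
    set v : ℤ → ℝ := fun x => (N - x) + N * (Real.exp (-θ * x) - Real.exp (-θ * N)) with hv
    set w : ℤ → ℝ := fun x => if x ∈ Finset.Icc 1 N then v x else 0 with hw
    have hwoff : ∀ x, x ∉ Finset.Icc 1 N → w x = 0 := fun x hx => by simp only [hw, if_neg hx]
    have hvsign : ∀ x : ℤ, x ≤ N → (N : ℝ) - x ≤ v x := fun x hx => by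
      have hx' : (x : ℝ) ≤ N := by exact_mod_cast hx
      have : Real.exp (-θ * N) ≤ Real.exp (-θ * x) := Real.exp_le_exp.2 (by nlinarith)
      simp only [hv]; nlinarith
    have hvneg : ∀ x : ℤ, N ≤ x → v x ≤ 0 := fun x hx => by
      have hx' : (N : ℝ) ≤ x := by exact_mod_cast hx
      have : Real.exp (-θ * x) ≤ Real.exp (-θ * N) := Real.exp_le_exp.2 (by nlinarith)
      simp only [hv]; nlinarith
    have hw0 : ∀ x, 0 ≤ w x := fun x => by
      simp only [hw]
      split_ifs with hx
      · have := hvsign x (Finset.mem_Icc.1 hx).2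
        have hx' : (x : ℝ) ≤ N := by exact_mod_cast (Finset.mem_Icc.1 hx).2
        linarith
      · rfl
    have hw2 : ∀ x, w x ≤ 2 * N := fun x => by
      simp only [hw]
      split_ifs with hx
      · have hx' : (1 : ℝ) ≤ x := by exact_mod_cast (Finset.mem_Icc.1 hx).1
        have h1 : Real.exp (-θ * x) ≤ 1 := Real.exp_le_one_iff.2 (by nlinarith)
        have h2 := Real.exp_pos (-θ * N)
        simp only [hv]; nlinarith
      · linarith
    have hwN : w N = 0 := by
      simp only [hw, hv]; split_ifs <;> simp
    have hT := fun y => hasSum_mul_sub_of_finset μ w (Finset.Icc 1 N) hwoff y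
    have hTnn : ∀ y, 0 ≤ ∑ x ∈ Finset.Icc 1 N, μ (y - x) * w x := fun y =>
      Finset.sum_nonneg fun x _ => mul_nonneg (hμ.nonneg _) (hw0 x)
    have hTfar : ∀ y : ℤ, K ≤ y → y ≤ N → p * w y ≤ ∑ x ∈ Finset.Icc 1 N, μ (y - x) * w x := by
      intro y hy hyN
      obtain ⟨d, hd0, hd⟩ := hK y hy
      have hlow := ((hμ.summable.hasSum.mul_right (v y)).add hμ.mean).add (hd.mul_left (N : ℝ))
      have hle := hasSum_le (fun k => ?_) hlow (hT y)
      · have : w y = v y := if_pos (Finset.mem_Icc.2 ⟨by omega, hyN⟩)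
        rw [this]
        have : 0 ≤ N * d := by positivity
        linarith
      · have key : v (y - k) - N * ((2 + 1 / θ) * Real.exp (-2 * θ * (y - k))) ≤ w (y - k) := by
          simp only [hw]
          split_ifs with hx
          · have : 0 ≤ (N : ℝ) * ((2 + 1 / θ) * Real.exp (-2 * θ * (y - k))) := by positivity
            linarith
          · rw [Finset.mem_Icc, not_and_or, not_le, not_le] at hx
            rcases hx with hx | hx
            · have hz : ((y - k : ℤ) : ℝ) ≤ 0 := by exact_mod_cast (by omega : y - k ≤ 0)
              have := exp_tent_le hθ hN1 hz
              simp only [hv]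
              push_cast at this ⊢
              linarith
            · have h1 := hvneg _ hx.le
              have : 0 ≤ (N : ℝ) * ((2 + 1 / θ) * Real.exp (-2 * θ * (y - k))) := by positivity
              linarith
        have := mul_le_mul_of_nonneg_left key (hμ.nonneg k)
        refine le_trans (le_of_eq ?_) this
        simp only [hv]
        push_cast
        ring
    have hTN : μ j * j ≤ ∑ x ∈ Finset.Icc 1 N, μ (N - x) * w x := by
      have hmem : N - j ∈ Finset.Icc 1 N := Finset.mem_Icc.2 ⟨by omega, by omega⟩
      refine le_trans ?_ (Finset.single_le_sum (f := fun x => μ (N - x) * w x)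
        (fun x _ => mul_nonneg (hμ.nonneg _) (hw0 x)) hmem)
      have h1 : w (N - j) = v (N - j) := if_pos hmem
      have h2 := hvsign (N - j) (by omega)
      simp only [sub_sub_cancel, h1]
      refine mul_le_mul_of_nonneg_left ?_ hμj.le
      push_cast at h2; linarith
    have hdual := hh.hasSum_duality w (Finset.Icc 1 N)
      (fun x hx => by have := (Finset.mem_Icc.1 hx).1; omega) hwoff
    have hD1 : HasSum (fun y : ℤ => if y = N then μ j * j * h N else 0) (μ j * j * h N) :=
      hasSum_ite_eq N _
    have hD2 := hasSum_sum_of_ne_finset_zero (L := .unconditional ℤ)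
      (f := fun y : ℤ => if y ∈ Finset.Icc 1 K then 2 * N * p * h y else 0) (s := Finset.Icc 1 K)
      (fun y hy => if_neg hy)
    have hS' : ∑ y ∈ Finset.Icc 1 K, (if y ∈ Finset.Icc 1 K then 2 * N * p * h y else 0)
        = 2 * N * p * S := by
      rw [hS, Finset.mul_sum]; exact Finset.sum_congr rfl fun y hy => if_pos hy
    rw [hS'] at hD2
    have := hasSum_le (fun y => ?_) (hD1.sub hD2) hdual
    · linarith
    · rcases le_or_gt y 0 with hy | hy
      · rw [hh.eq_zero y hy, if_neg (by omega), if_neg (by simp; omega), sub_zero, mul_zero]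
      have hcoef : (if y = N then μ j * j else 0) - (if y ∈ Finset.Icc 1 K then 2 * N * p else 0)
          ≤ ∑ x ∈ Finset.Icc 1 N, μ (y - x) * w x - p * w y := by
        have hpN : 0 ≤ 2 * N * p := by positivity
        by_cases hyN : y = N
        · subst hyN
          rw [if_pos rfl, hwN, mul_zero, sub_zero]
          split_ifs <;> linarith
        · rw [if_neg hyN]
          by_cases hyK : y ∈ Finset.Icc 1 K
          · rw [if_pos hyK]
            have := mul_le_mul_of_nonneg_left (hw2 y) hp.le
            linarith [hTnn y]
          · rw [if_neg hyK]
            have hyK' : K ≤ y := by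
              simp only [Finset.mem_Icc, not_and, not_le] at hyK
              exact (hyK (by omega)).le
            rcases le_or_gt y N with hyN' | hyN'
            · linarith [hTfar y hyK' hyN']
            · rw [hwoff y (by simp; omega), mul_zero]
              linarith [hTnn y]
      have := mul_le_mul_of_nonneg_right hcoef (hh.nonneg y)
      refine le_trans (le_of_eq ?_) this
      rw [sub_mul, ite_mul, ite_mul, zero_mul]
      congr 1
      split_ifs with hyN
      · rw [hyN]
      · rfl
  set S2 := ∑ y ∈ Finset.Icc 1 j, h y with hS2
  have hS20 : 0 ≤ S2 := Finset.sum_nonneg fun y _ => hh.nonneg y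
  refine ⟨2 * p * S / (μ j * j) + S2 + 1, by positivity, fun x hx => ?_⟩
  have hx1 : (1 : ℝ) ≤ x := by exact_mod_cast hx
  have hA : 0 ≤ 2 * p * S / (μ j * j) := by positivity
  rcases le_or_gt x j with hxj | hxj
  · have : h x ≤ S2 := Finset.single_le_sum (f := h) (fun y _ => hh.nonneg y)
      (Finset.mem_Icc.2 ⟨by omega, hxj⟩)
    nlinarith
  · have h1 := main x hxj
    have : h x ≤ 2 * p * S / (μ j * j) * x := by
      rw [div_mul_eq_mul_div, le_div_iff₀ (by positivity)]
      linarith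
    nlinarith

/-- One step of the walk on `ℤ` between positive integers. -/
def HalfLineStep (μ : ℤ → ℝ) (x y : ℤ) : Prop := 0 < x ∧ 0 < y ∧ 0 < μ (y - x)

theorem HalfLineHarmonic.exists_le_mul_of_reach (hμ : CenteredLaw μ θ) {x y : ℤ}
    (hxy : Relation.ReflTransGen (HalfLineStep μ) x y) :
    ∃ c : ℝ, 0 < c ∧ ∀ h, HalfLineHarmonic μ h → ∀ n : ℤ, 0 ≤ n → h (y + n) ≤ c * h (x + n) := by
  have hp := hμ.tsum_pos
  induction hxy with
  | refl => exact ⟨1, one_pos, fun h _ n _ => by simp⟩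
  | @tail y z _ hstep ih =>
    obtain ⟨c, hc, ih⟩ := ih
    obtain ⟨hy, hz, hyz⟩ := hstep
    refine ⟨(∑' k, μ k) / μ (z - y) * c, by positivity, fun h hh n hn => ?_⟩
    have h1 := le_hasSum (hh.hasSum (y + n) (by omega)) (z + n)
      (fun k _ => mul_nonneg (hμ.nonneg _) (hh.nonneg _))
    rw [add_sub_add_right_eq_sub] at h1
    have h2 : h (z + n) ≤ (∑' k, μ k) / μ (z - y) * h (y + n) := by
      rw [div_mul_eq_mul_div, le_div_iff₀ hyz]; linarith
    refine h2.trans ?_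
    rw [mul_assoc]
    exact mul_le_mul_of_nonneg_left (ih h hh n hn) (by positivity)

/-- Local Harnack inequality. -/
theorem HalfLineHarmonic.exists_shift_le (hμ : CenteredLaw μ θ)
    (hirr : ∀ x y : ℤ, 0 < x → 0 < y → Relation.ReflTransGen (HalfLineStep μ) x y) (t : ℤ) :
    ∃ c : ℝ, 0 < c ∧ ∀ h, HalfLineHarmonic μ h → ∀ x : ℤ, 0 < x → h (x + t) ≤ c * h x := by
  obtain ⟨c1, hc1, h1⟩ := HalfLineHarmonic.exists_le_mul_of_reach hμ (hirr 1 2 (by simp) (by simp))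
  obtain ⟨c2, hc2, h2⟩ := HalfLineHarmonic.exists_le_mul_of_reach hμ (hirr 2 1 (by simp) (by simp))
  have up : ∀ n : ℕ, ∃ c : ℝ, 0 < c ∧ ∀ h, HalfLineHarmonic μ h → ∀ x : ℤ, 0 < x →
      h (x + n) ≤ c * h x := by
    intro n
    induction n with
    | zero => exact ⟨1, one_pos, fun h _ x _ => by simp⟩
    | succ n ih =>
      obtain ⟨c, hc, ih⟩ := ih
      refine ⟨c1 * c, by positivity, fun h hh x hx => ?_⟩
      have a := h1 h hh (x + n - 1) (by omega)
      rw [show (2 : ℤ) + (x + n - 1) = x + (n + 1 : ℕ) by push_cast; ring,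
        show (1 : ℤ) + (x + n - 1) = x + n by ring] at a
      refine a.trans ?_
      rw [mul_assoc]
      exact mul_le_mul_of_nonneg_left (ih h hh x hx) hc1.le
  have down : ∀ n : ℕ, ∃ c : ℝ, 0 < c ∧ ∀ h, HalfLineHarmonic μ h → ∀ x : ℤ, 0 < x →
      h (x - n) ≤ c * h x := by
    intro n
    induction n with
    | zero => exact ⟨1, one_pos, fun h _ x _ => by simp⟩
    | succ n ih =>
      obtain ⟨c, hc, ih⟩ := ih
      refine ⟨c2 * c, by positivity, fun h hh x hx => ?_⟩
      rcases le_or_gt (x - (n + 1 : ℕ)) 0 with hn | hn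
      · rw [hh.eq_zero _ hn]
        exact mul_nonneg (by positivity) (hh.nonneg _)
      have a := h2 h hh (x - n - 2) (by push_cast at hn; omega)
      rw [show (1 : ℤ) + (x - n - 2) = x - (n + 1 : ℕ) by push_cast; ring,
        show (2 : ℤ) + (x - n - 2) = x - n by ring] at a
      refine a.trans ?_
      rw [mul_assoc]
      exact mul_le_mul_of_nonneg_left (ih h hh x hx) hc2.le
  rcases Int.eq_nat_or_neg t with ⟨n, rfl | rfl⟩
  · exact up n
  · simpa [sub_eq_add_neg] using down n

end HalfLineUniqueness

section HalfLineProportional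

variable {μ : ℤ → ℝ} {θ : ℝ} {h : ℤ → ℝ}

theorem max_add_le (hθ : 0 < θ) (t k : ℝ) :
    max (t + k) 0 ≤ max t 0 + (if 0 ≤ t then k else 0)
      + 1 / θ * (Real.exp (2 * θ * |k|) * Real.exp (-θ * |t|)) := by
  have hpos : 0 ≤ 1 / θ * (Real.exp (2 * θ * |k|) * Real.exp (-θ * |t|)) := by positivity
  have hbig : |t| ≤ |k| → |k| ≤ 1 / θ * (Real.exp (2 * θ * |k|) * Real.exp (-θ * |t|)) := by
    intro htk
    rw [← Real.exp_add, one_div, ← div_eq_inv_mul, le_div_iff₀ hθ]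
    have h1 := Real.add_one_le_exp (2 * θ * |k| + -θ * |t|)
    nlinarith [abs_nonneg k]
  rcases le_or_gt 0 t with ht | ht
  · rw [if_pos ht, max_eq_left ht]
    rcases le_or_gt 0 (t + k) with h | h
    · rw [max_eq_left h]; linarith
    · rw [max_eq_right h.le]
      have hk : |k| = -k := abs_of_neg (by linarith)
      have := hbig (by rw [abs_of_nonneg ht, hk]; linarith)
      linarith
  · rw [if_neg (not_le.2 ht), max_eq_right ht.le]
    refine max_le ?_ (by linarith)
    rcases le_or_gt (t + k) 0 with h | h
    · linarith
    · have := hbig (by rw [abs_of_neg ht, abs_of_pos (by linarith)]; linarith)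
      linarith [le_abs_self k]

theorem tent_le (N x : ℤ) :
    (if x ∈ Finset.Icc 1 N then max ((N : ℝ) - x) 0 else 0) ≤ max ((N : ℝ) - x) 0 := by
  split_ifs
  · rfl
  · exact le_max_right _ _

theorem tent_eq (N x : ℤ) (hx : 0 < x) :
    (if x ∈ Finset.Icc 1 N then max ((N : ℝ) - x) 0 else 0) = max ((N : ℝ) - x) 0 := by
  split_ifs with h'
  · rfl
  · rw [Finset.mem_Icc] at h'
    have : (N : ℝ) ≤ x := by exact_mod_cast (by omega : N ≤ x)
    rw [max_eq_right (by linarith)]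

theorem tent_step_le (hμ : CenteredLaw μ θ) {j : ℤ} (hj : 0 < j) (N y k : ℤ) :
    μ k * (if y - k ∈ Finset.Icc 1 N then max ((N : ℝ) - (y - k : ℤ)) 0 else 0)
      ≤ μ k * max ((N : ℝ) - y) 0 + (if (0 : ℝ) ≤ N - y then 1 else 0) * (μ k * (k : ℝ))
        + 1 / θ * Real.exp (-θ * |(N : ℝ) - y|) * (μ k * Real.exp (2 * θ * |(k : ℝ)|))
        - (if k = j then (if y = 1 then μ j * (N : ℝ) else 0) else 0) := by
  have key := mul_le_mul_of_nonneg_left (max_add_le hμ.theta_pos ((N : ℝ) - y) k) (hμ.nonneg k)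
  have e : (N : ℝ) - y + k = N - (y - k : ℤ) := by push_cast; ring
  have hm : (if (0 : ℝ) ≤ N - y then (k : ℝ) else 0)
    = (if (0 : ℝ) ≤ N - y then 1 else 0) * k := by split_ifs <;> simp
  rw [e, hm] at key
  by_cases hcase : k = j ∧ y = 1
  · obtain ⟨rfl, rfl⟩ := hcase
    rw [if_pos rfl, if_pos rfl, if_neg (by rw [Finset.mem_Icc]; omega), mul_zero]
    have : (N : ℝ) ≤ max ((N : ℝ) - (1 - k : ℤ)) 0 := le_max_of_le_left (by
      push_cast; have : (1 : ℝ) ≤ k := by exact_mod_cast hj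
      linarith)
    have := mul_le_mul_of_nonneg_left this (hμ.nonneg k)
    linarith
  · have : (if k = j then (if y = 1 then μ j * (N : ℝ) else 0) else 0) = 0 := by
      rcases not_and_or.1 hcase with h' | h'
      · rw [if_neg h']
      · rw [if_neg h', ite_self]
    rw [this]
    have := mul_le_mul_of_nonneg_left (tent_le N (y - k)) (hμ.nonneg k)
    linarith

theorem tent_sum_le (hμ : CenteredLaw μ θ) {j : ℤ} (hj : 0 < j) (N y : ℤ) (hy : 0 < y) :
    ∑ x ∈ Finset.Icc 1 N, μ (y - x) * (if x ∈ Finset.Icc 1 N then max ((N : ℝ) - x) 0 else 0)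
        - (∑' k, μ k) * (if y ∈ Finset.Icc 1 N then max ((N : ℝ) - y) 0 else 0)
      ≤ 1 / θ * (∑' k : ℤ, μ k * Real.exp (2 * θ * |(k : ℝ)|)) * Real.exp (-θ * |(y : ℝ) - N|)
        - (if y = 1 then μ j * N else 0) := by
  have hupp := (((hμ.summable.hasSum.mul_right (max ((N : ℝ) - y) 0)).add
    (hμ.mean.mul_left (if (0 : ℝ) ≤ N - y then 1 else 0))).add
    (hμ.exp_moment.hasSum.mul_left (1 / θ * Real.exp (-θ * |(N : ℝ) - y|)))).sub
    (hasSum_ite_eq j (if y = 1 then μ j * (N : ℝ) else 0))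
  have := hasSum_le (fun k => tent_step_le hμ hj N y k)
    (hasSum_mul_sub_of_finset μ
      (fun x => if x ∈ Finset.Icc 1 N then max ((N : ℝ) - x) 0 else 0) (Finset.Icc 1 N)
      (fun x hx => if_neg hx) y) hupp
  rw [tent_eq N y hy, abs_sub_comm (y : ℝ) N]
  rw [mul_zero, add_zero] at this
  linarith

theorem summable_one_add_abs_mul_exp (hθ : 0 < θ) :
    Summable fun t : ℤ => (1 + |(t : ℝ)|) * Real.exp (-θ * |(t : ℝ)|) := by
  have hnat : Summable fun n : ℕ => (1 + (n : ℝ)) * Real.exp (-θ * n) := by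
    have a := Real.summable_pow_mul_exp_neg_nat_mul 0 hθ
    have b := Real.summable_pow_mul_exp_neg_nat_mul 1 hθ
    refine (a.add b).congr fun n => by ring
  refine Summable.of_nat_of_neg ?_ ?_
  · simpa using hnat
  · simpa using hnat

/-- The exponentially localised mass of a half-line harmonic function near `N` is controlled by
its value at `N`, up to a small linear error. -/
theorem HalfLineHarmonic.exists_localised_mass_le (hμ : CenteredLaw μ θ)
    (hirr : ∀ x y : ℤ, 0 < x → 0 < y → Relation.ReflTransGen (HalfLineStep μ) x y)
    (hh : HalfLineHarmonic μ h) {ε : ℝ} (hε : 0 < ε) :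
    ∃ Q : ℝ, 0 ≤ Q ∧ ∀ N : ℤ, 0 < N → ∃ φ : ℤ → ℝ, (∃ s ≤ Q * h N + N * ε, HasSum φ s) ∧
      ∀ y : ℤ, h y * Real.exp (-θ * |(y : ℝ) - N|) ≤ φ y := by
  obtain ⟨C, hC, hup⟩ := hh.exists_le_mul hμ
  choose D hD0 hD using HalfLineHarmonic.exists_shift_le hμ hirr
  have hθ := hμ.theta_pos
  set E : ℤ → ℝ := fun t => (1 + |(t : ℝ)|) * Real.exp (-θ * |(t : ℝ)|) with hE
  have hEs : Summable E := summable_one_add_abs_mul_exp hθ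
  have hE0 : ∀ t, 0 ≤ E t := fun t => by simp only [hE]; positivity
  obtain ⟨T, hT⟩ : ∃ T : Finset ℤ, ∑' t : {t // t ∉ T}, E t < ε / C :=
    ((tendsto_order.1 (tendsto_tsum_compl_atTop_zero E)).2 (ε / C) (by positivity)).exists
  set F : ℤ → ℝ := fun t => if t ∈ T then 0 else E t with hF
  have hFs : HasSum F (∑' t : {t // t ∉ T}, E t) := by
    have := hasSum_subtype_iff_indicator (f := E) (s := {t | t ∉ T}).1
      (hEs.subtype {t | t ∉ T}).hasSum
    refine this.congr_fun ?_
    intro t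
    by_cases ht : t ∈ T
    · simp only [hF, if_pos ht]
      exact (Set.indicator_of_notMem (s := {t | t ∉ T}) (fun h' => h' ht) E).symm
    · simp only [hF, if_neg ht]
      exact (Set.indicator_of_mem (s := {t | t ∉ T}) ht E).symm
  refine ⟨∑ t ∈ T, D t, Finset.sum_nonneg fun t _ => (hD0 t).le, fun N hN =>
    ⟨fun y => (if y - N ∈ T then D (y - N) * h N else 0) + C * N * F (y - N), ?_, ?_⟩⟩
  · have hnear : HasSum (fun y : ℤ => if y - N ∈ T then D (y - N) * h N else 0)
        ((∑ t ∈ T, D t) * h N) := by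
      have a := hasSum_sum_of_ne_finset_zero (L := .unconditional ℤ)
        (f := fun t : ℤ => if t ∈ T then D t * h N else 0) (s := T) (fun t ht => if_neg ht)
      have e : ∑ t ∈ T, (if t ∈ T then D t * h N else 0) = (∑ t ∈ T, D t) * h N := by
        rw [Finset.sum_mul]; exact Finset.sum_congr rfl fun t ht => if_pos ht
      rw [e] at a
      exact (Equiv.subRight N).hasSum_iff (f := fun t : ℤ => if t ∈ T then D t * h N else 0)
        |>.2 a
    have hfar : HasSum (fun y : ℤ => C * N * F (y - N)) (C * N * ∑' t : {t // t ∉ T}, E t) :=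
      (((Equiv.subRight N).hasSum_iff (f := F)).2 hFs).mul_left _
    refine ⟨_, ?_, hnear.add hfar⟩
    have hN' : (0 : ℝ) < N := by exact_mod_cast hN
    have : C * N * ∑' t : {t // t ∉ T}, E t ≤ C * N * (ε / C) := by gcongr
    have e : C * N * (ε / C) = N * ε := by field_simp
    linarith
  · intro y
    have hN1 : (1 : ℝ) ≤ N := by exact_mod_cast hN
    have hexp : Real.exp (-θ * |(y : ℝ) - N|) ≤ 1 :=
      Real.exp_le_one_iff.2 (by nlinarith [abs_nonneg ((y : ℝ) - N)])
    by_cases hy : y - N ∈ T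
    · simp only [hF, if_pos hy, mul_zero, add_zero]
      have := hD (y - N) h hh N hN
      rw [add_sub_cancel] at this
      exact (mul_le_of_le_one_right (hh.nonneg y) hexp).trans this
    · simp only [hF, if_neg hy, zero_add]
      rcases le_or_gt y 0 with hy0 | hy0
      · rw [hh.eq_zero y hy0, zero_mul]
        exact mul_nonneg (by positivity) (hE0 _)
      · have a := hup y hy0
        have b : (y : ℝ) ≤ N * (1 + |(y : ℝ) - N|) := by
          nlinarith [le_abs_self ((y : ℝ) - N), abs_nonneg ((y : ℝ) - N)]
        have c : h y ≤ C * (N * (1 + |(y : ℝ) - N|)) :=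
          a.trans (mul_le_mul_of_nonneg_left b hC.le)
        have := mul_le_mul_of_nonneg_right c (Real.exp_pos (-θ * |(y : ℝ) - N|)).le
        refine this.trans (le_of_eq ?_)
        simp only [hE]; push_cast; ring

theorem linear_lower_aux (hμ : CenteredLaw μ θ) (hh : HalfLineHarmonic μ h) {j : ℤ}
    (hj : 0 < j) {B : ℝ} (hB : B = 1 / θ * ∑' k : ℤ, μ k * Real.exp (2 * θ * |(k : ℝ)|))
    (hB0 : 0 ≤ B) (N : ℤ) {φ : ℤ → ℝ} {s : ℝ} (hs : HasSum φ s)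
    (hφ : ∀ y : ℤ, h y * Real.exp (-θ * |(y : ℝ) - N|) ≤ φ y) :
    μ j * N * h 1 ≤ B * s := by
  have hdual := hh.hasSum_duality
    (fun x => if x ∈ Finset.Icc 1 N then max ((N : ℝ) - x) 0 else 0) (Finset.Icc 1 N)
    (fun x hx => by have := (Finset.mem_Icc.1 hx).1; omega) (fun x hx => if_neg hx)
  have hfin := hasSum_le (fun y => ?_) hdual
    ((hs.mul_left B).sub (hasSum_ite_eq (1 : ℤ) (μ j * N * h 1)))
  · linarith
  · rcases le_or_gt y 0 with hy | hy
    · rw [hh.eq_zero y hy, mul_zero, if_neg (show y ≠ 1 by omega), sub_zero]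
      exact mul_nonneg hB0 ((mul_nonneg (hh.nonneg y) (Real.exp_pos _).le).trans (hφ y))
    · have a := mul_le_mul_of_nonneg_right (tent_sum_le hμ hj N y hy) (hh.nonneg y)
      have b := mul_le_mul_of_nonneg_left (hφ y) hB0
      rw [← hB] at a
      refine a.trans ?_
      by_cases hy1 : y = 1
      · subst hy1
        rw [if_pos rfl, if_pos rfl]
        linarith
      · rw [if_neg hy1, if_neg hy1]
        linarith

/-- Nonzero harmonic functions on the half-line grow at least linearly. -/
theorem HalfLineHarmonic.exists_mul_le (hμ : CenteredLaw μ θ)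
    (hirr : ∀ x y : ℤ, 0 < x → 0 < y → Relation.ReflTransGen (HalfLineStep μ) x y)
    (hh : HalfLineHarmonic μ h) (h1 : 0 < h 1) :
    ∃ c : ℝ, 0 < c ∧ ∀ x : ℤ, 0 < x → c * x ≤ h x := by
  obtain ⟨j, hj, hμj⟩ := hμ.exists_pos_step
  have hθ := hμ.theta_pos
  obtain ⟨B, hB⟩ : ∃ B, B = 1 / θ * ∑' k : ℤ, μ k * Real.exp (2 * θ * |(k : ℝ)|) := ⟨_, rfl⟩
  have hB0 : 0 ≤ B := hB ▸ mul_nonneg (by positivity)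
    (tsum_nonneg fun k => mul_nonneg (hμ.nonneg k) (Real.exp_pos _).le)
  have hμh : 0 < μ j * h 1 := mul_pos hμj h1
  obtain ⟨ε, hε⟩ : ∃ ε, ε = μ j * h 1 / (2 * (B + 1)) := ⟨_, rfl⟩
  have hε0 : 0 < ε := by rw [hε]; positivity
  obtain ⟨Q, hQ, H⟩ := hh.exists_localised_mass_le hμ hirr hε0
  refine ⟨μ j * h 1 / (2 * (B * Q + 1)), by positivity, fun x hx => ?_⟩
  have hx1 : (1 : ℝ) ≤ x := by exact_mod_cast hx
  obtain ⟨φ, ⟨s, hs, hφs⟩, hφ⟩ := H x hx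
  have hm := (linear_lower_aux hμ hh hj hB hB0 x hφs hφ).trans (mul_le_mul_of_nonneg_left hs hB0)
  have hε' : B * ε ≤ μ j * h 1 / 2 := by
    have : ε * (B + 1) = μ j * h 1 / 2 := by rw [hε]; field_simp
    nlinarith
  have h2 : μ j * h 1 / 2 * x ≤ (B * Q + 1) * h x := by
    have := mul_le_mul_of_nonneg_right hε' (by linarith : (0 : ℝ) ≤ x)
    nlinarith [hh.nonneg x]
  have hBQ : 0 < B * Q + 1 := by positivity
  rw [div_mul_eq_mul_div, div_le_iff₀ (by positivity)]
  linarith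

theorem HalfLineHarmonic.pos_of_pos (hμ : CenteredLaw μ θ)
    (hirr : ∀ x y : ℤ, 0 < x → 0 < y → Relation.ReflTransGen (HalfLineStep μ) x y)
    (hh : HalfLineHarmonic μ h) {x y : ℤ} (hx : 0 < x) (hy : 0 < y) (hpos : 0 < h x) :
    0 < h y := by
  obtain ⟨c, hc, H⟩ := HalfLineHarmonic.exists_le_mul_of_reach hμ (hirr y x hy hx)
  have := H h hh 0 le_rfl
  simp only [add_zero] at this
  exact pos_of_mul_pos_right (hpos.trans_le this) hc.le

/-- Two harmonic functions on the half-line are proportional. -/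
theorem HalfLineHarmonic.proportional (hμ : CenteredLaw μ θ)
    (hirr : ∀ x y : ℤ, 0 < x → 0 < y → Relation.ReflTransGen (HalfLineStep μ) x y)
    {f g : ℤ → ℝ} (hf : HalfLineHarmonic μ f) (hg : HalfLineHarmonic μ g) (hg1 : 0 < g 1) :
    ∃ c : ℝ, ∀ x, f x = c * g x := by
  have hgpos : ∀ x : ℤ, 0 < x → 0 < g x := fun x hx => hg.pos_of_pos hμ hirr one_pos hx hg1
  set S : Set ℝ := (fun x : ℤ => f x / g x) '' {x | 0 < x} with hS
  have hSne : S.Nonempty := ⟨_, 1, by simp, rfl⟩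
  have hSbdd : BddBelow S := ⟨0, by
    rintro _ ⟨x, hx, rfl⟩; exact div_nonneg (hf.nonneg x) (hg.nonneg x)⟩
  set c := sInf S with hc
  have hcle : ∀ x : ℤ, 0 < x → c * g x ≤ f x := fun x hx => by
    rw [← le_div_iff₀ (hgpos x hx)]
    exact csInf_le hSbdd ⟨x, hx, rfl⟩
  have hd : HalfLineHarmonic μ (fun x => f x - c * g x) :=
    { nonneg := fun x => by
        rcases le_or_gt x 0 with hx | hx
        · simp [hf.eq_zero x hx, hg.eq_zero x hx]
        · linarith [hcle x hx]
      eq_zero := fun x hx => by simp [hf.eq_zero x hx, hg.eq_zero x hx]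
      hasSum := fun x hx => by
        have := (hf.hasSum x hx).sub ((hg.hasSum x hx).mul_left c)
        rw [show (∑' k, μ k) * (f x - c * g x)
          = (∑' k, μ k) * f x - c * ((∑' k, μ k) * g x) by ring]
        refine this.congr_fun ?_
        intro y; ring }
  by_cases hpos : 0 < f 1 - c * g 1
  · exfalso
    obtain ⟨a, ha, hlow⟩ := hd.exists_mul_le hμ hirr hpos
    obtain ⟨b, hb, hup⟩ := hg.exists_le_mul hμ
    have : c + a / b ≤ c := by
      refine le_csInf hSne ?_
      rintro _ ⟨x, hx, rfl⟩
      change c + a / b ≤ f x / g x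
      rw [le_div_iff₀ (hgpos x hx)]
      have h1 := hlow x hx
      have h2 : a / b * g x ≤ a * x := by
        rw [div_mul_eq_mul_div, div_le_iff₀ hb]
        have := mul_le_mul_of_nonneg_left (hup x hx) ha.le
        linarith
      linarith
    have : 0 < a / b := by positivity
    linarith
  · refine ⟨c, fun x => ?_⟩
    rcases le_or_gt x 0 with hx | hx
    · simp [hf.eq_zero x hx, hg.eq_zero x hx]
    · by_contra hne
      have : 0 < f x - c * g x := lt_of_le_of_ne (hd.nonneg x) (Ne.symm (sub_ne_zero.2 hne))
      exact hpos (hd.pos_of_pos hμ hirr hx one_pos this)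

end HalfLineProportional

section KilledOperator

open scoped ENNReal

variable {V : Type*} [AddCommGroup V]

/-- The transition operator of the walk with step weights `σ` killed outside `A`, acting on
functions with values in `[0, ∞]`. -/
noncomputable def killedOp (σ : V → ℝ) (A : Set V) (G : V → ℝ≥0∞) (x : V) : ℝ≥0∞ :=
  if x ∈ A then ∑' w, ENNReal.ofReal (σ w) * (if x + w ∈ A then G (x + w) else 0) else 0

variable {σ τ : V → ℝ} {A : Set V}

theorem killedOp_of_mem (G : V → ℝ≥0∞) {x : V} (hx : x ∈ A) :
    killedOp σ A G x = ∑' w, ENNReal.ofReal (σ w) * (if x + w ∈ A then G (x + w) else 0) :=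
  if_pos hx

theorem killedOp_of_notMem (G : V → ℝ≥0∞) {x : V} (hx : x ∉ A) : killedOp σ A G x = 0 :=
  if_neg hx

theorem killedOp_mono : Monotone (killedOp σ A) := by
  intro G H hGH x
  unfold killedOp
  split_ifs
  · refine ENNReal.tsum_le_tsum fun w => ?_
    gcongr
    split_ifs
    · exact hGH _
    · rfl
  · rfl

theorem killedOp_add (G H : V → ℝ≥0∞) :
    killedOp σ A (G + H) = killedOp σ A G + killedOp σ A H := by
  funext x
  by_cases hx : x ∈ A
  · rw [Pi.add_apply, killedOp_of_mem _ hx, killedOp_of_mem _ hx, killedOp_of_mem _ hx,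
      ← ENNReal.tsum_add]
    refine tsum_congr fun w => ?_
    rw [← mul_add]
    congr 1
    split_ifs <;> simp
  · rw [Pi.add_apply, killedOp_of_notMem _ hx, killedOp_of_notMem _ hx, killedOp_of_notMem _ hx,
      add_zero]

theorem killedOp_const_mul (c : ℝ≥0∞) (G : V → ℝ≥0∞) :
    killedOp σ A (fun x => c * G x) = fun x => c * killedOp σ A G x := by
  funext x
  by_cases hx : x ∈ A
  · rw [killedOp_of_mem _ hx, killedOp_of_mem _ hx, ← ENNReal.tsum_mul_left]
    refine tsum_congr fun w => ?_
    split_ifs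
    · ring
    · simp
  · rw [killedOp_of_notMem _ hx, killedOp_of_notMem _ hx, mul_zero]

theorem killedOp_tsum {ι : Type*} (G : ι → V → ℝ≥0∞) :
    killedOp σ A (fun x => ∑' n, G n x) = fun x => ∑' n, killedOp σ A (G n) x := by
  funext x
  by_cases hx : x ∈ A
  · simp only [killedOp_of_mem _ hx]
    rw [ENNReal.tsum_comm]
    refine tsum_congr fun w => ?_
    rw [ENNReal.tsum_mul_left]
    congr 1
    split_ifs <;> simp
  · simp [killedOp_of_notMem _ hx]

theorem killedOp_weight_add (hσ : ∀ w, 0 ≤ σ w) (hτ : ∀ w, 0 ≤ τ w) (G : V → ℝ≥0∞) :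
    killedOp (fun w => σ w + τ w) A G = killedOp σ A G + killedOp τ A G := by
  funext x
  by_cases hx : x ∈ A
  · rw [Pi.add_apply, killedOp_of_mem _ hx, killedOp_of_mem _ hx, killedOp_of_mem _ hx,
      ← ENNReal.tsum_add]
    refine tsum_congr fun w => ?_
    rw [ENNReal.ofReal_add (hσ w) (hτ w), add_mul]
  · rw [Pi.add_apply, killedOp_of_notMem _ hx, killedOp_of_notMem _ hx, killedOp_of_notMem _ hx,
      add_zero]

/-- Killed operators commute as soon as every commuting square of jumps with two opposite corners
in `A` lies in `A`. -/
theorem killedOp_comm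
    (hcross : ∀ x ∈ A, ∀ w v, σ w ≠ 0 → τ v ≠ 0 → x + w + v ∈ A → x + w ∈ A ∧ x + v ∈ A) :
    Function.Commute (killedOp σ A) (killedOp τ A) := by
  intro G
  funext x
  by_cases hx : x ∈ A
  · rw [killedOp_of_mem _ hx, killedOp_of_mem _ hx]
    have e1 : ∀ w, ENNReal.ofReal (σ w) * (if x + w ∈ A then killedOp τ A G (x + w) else 0)
        = ∑' v, ENNReal.ofReal (σ w) * (ENNReal.ofReal (τ v) *
          if x + w + v ∈ A then G (x + w + v) else 0) := by
      intro w
      rw [ENNReal.tsum_mul_left]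
      by_cases hσ : σ w = 0
      · simp [hσ]
      by_cases hw : x + w ∈ A
      · rw [if_pos hw, killedOp_of_mem _ hw]
      · rw [if_neg hw]
        congr 1
        symm
        rw [ENNReal.tsum_eq_zero]
        intro v
        by_cases hτ : τ v = 0
        · simp [hτ]
        rw [if_neg fun h => hw (hcross x hx w v hσ hτ h).1, mul_zero]
    have e2 : ∀ v, ENNReal.ofReal (τ v) * (if x + v ∈ A then killedOp σ A G (x + v) else 0)
        = ∑' w, ENNReal.ofReal (σ w) * (ENNReal.ofReal (τ v) *
          if x + w + v ∈ A then G (x + w + v) else 0) := by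
      intro v
      by_cases hτ : τ v = 0
      · simp [hτ]
      by_cases hv : x + v ∈ A
      · rw [if_pos hv, killedOp_of_mem _ hv, ← ENNReal.tsum_mul_left]
        refine tsum_congr fun w => ?_
        rw [add_right_comm x v w]
        ring
      · rw [if_neg hv, mul_zero]
        symm
        rw [ENNReal.tsum_eq_zero]
        intro w
        by_cases hσ : σ w = 0
        · simp [hσ]
        rw [if_neg fun h => hv (hcross x hx w v hσ hτ h).2, mul_zero, mul_zero]
    rw [tsum_congr e1, tsum_congr e2, ENNReal.tsum_comm]
  · rw [killedOp_of_notMem _ hx, killedOp_of_notMem _ hx]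

theorem iterate_killedOp_add (k : ℕ) (G H : V → ℝ≥0∞) :
    (killedOp σ A)^[k] (G + H) = (killedOp σ A)^[k] G + (killedOp σ A)^[k] H := by
  induction k with
  | zero => rfl
  | succ k ih => rw [Function.iterate_succ_apply', ih, killedOp_add,
      ← Function.iterate_succ_apply' (killedOp σ A), ← Function.iterate_succ_apply' (killedOp σ A)]

/-- Harnack inequality for an irreducible killed walk. -/
theorem exists_mul_le_of_irred {ν : V → ℝ} (hirr : Irred ν A) {u y : V} (hu : u ∈ A)
    (hy : y ∈ A) : ∃ c : ℝ≥0∞, c ≠ 0 ∧ c ≠ ⊤ ∧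
      ∀ H : V → ℝ≥0∞, killedOp ν A H = H → c * H u ≤ H y := by
  obtain ⟨k, p, h0, hk, hA, hstep⟩ := hirr y hy u hu
  have key : ∀ j ≤ k, ∃ c : ℝ≥0∞, c ≠ 0 ∧ c ≠ ⊤ ∧
      ∀ H : V → ℝ≥0∞, killedOp ν A H = H → c * H (p j) ≤ H (p 0) := by
    intro j hj
    induction j with
    | zero => exact ⟨1, one_ne_zero, ENNReal.one_ne_top, fun H _ => by rw [one_mul]⟩
    | succ j ih =>
      obtain ⟨c, hc0, hct, hc⟩ := ih (by omega)
      have hpos := hstep j (by omega)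
      refine ⟨c * ENNReal.ofReal (ν (p (j + 1) - p j)),
        mul_ne_zero hc0 (by simpa using hpos), ENNReal.mul_ne_top hct ENNReal.ofReal_ne_top,
        fun H hH => ?_⟩
      refine le_trans ?_ (hc H hH)
      rw [mul_assoc]
      gcongr
      conv_rhs => rw [← hH, killedOp_of_mem _ (hA j (by omega))]
      refine le_trans (le_of_eq ?_) (ENNReal.le_tsum (p (j + 1) - p j))
      rw [add_sub_cancel, if_pos (hA (j + 1) hj)]
  obtain ⟨c, hc0, hct, hc⟩ := key k le_rfl
  exact ⟨c, hc0, hct, fun H hH => by simpa [h0, hk] using hc H hH⟩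

theorem exists_mul_le_on_finset_of_irred {ν : V → ℝ} (hirr : Irred ν A) {u : V} (hu : u ∈ A)
    (T : Finset V) (hT : ∀ y ∈ T, y ∈ A) : ∃ c : ℝ≥0∞, c ≠ 0 ∧ c ≠ ⊤ ∧
      ∀ H : V → ℝ≥0∞, killedOp ν A H = H → ∀ y ∈ T, c * H u ≤ H y := by
  induction T using Finset.induction_on with
  | empty => exact ⟨1, one_ne_zero, ENNReal.one_ne_top, fun H _ y hy => by simp at hy⟩
  | insert a T _ ih =>
    obtain ⟨c, hc0, hct, hc⟩ := ih fun y hy => hT y (Finset.mem_insert_of_mem hy)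
    obtain ⟨d, hd0, hdt, hd⟩ := exists_mul_le_of_irred hirr hu (hT a (Finset.mem_insert_self a T))
    refine ⟨min c d, by simp [hc0, hd0], by simp [hct],
      fun H hH y hy => ?_⟩
    rcases Finset.mem_insert.1 hy with rfl | hy
    · exact (mul_le_mul_left (min_le_right c d) _).trans (hd H hH)
    · exact (mul_le_mul_left (min_le_left c d) _).trans (hc H hH y hy)

/-- If the killed operator splits as a sum of commuting operators `a + b` and `a` has almost
eigenfunctions of finite support with eigenvalue close to `p`, then harmonic functions satisfy
`p G ≤ a G`. -/
theorem mul_le_killedOp_of_test (hσ : ∀ w, 0 ≤ σ w) (hτ : ∀ w, 0 ≤ τ w)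
    (hirr : Irred (fun w => σ w + τ w) A)
    (hcross : ∀ x ∈ A, ∀ w v, σ w ≠ 0 → τ v ≠ 0 → x + w + v ∈ A → x + w ∈ A ∧ x + v ∈ A)
    {p : ℝ} {u : V} (hu : u ∈ A)
    (htest : ∀ q, 0 ≤ q → q < p → ∃ (T : Finset V) (W : V → ℝ≥0∞), W u ≠ 0 ∧ (∀ y ∈ T, y ∈ A) ∧
      (∀ y, y ∉ T → W y = 0) ∧ (∀ y, W y ≤ 1) ∧
      ∀ x, ENNReal.ofReal q * W x ≤ killedOp σ A W x)
    {G : V → ℝ≥0∞} (hG : killedOp (fun w => σ w + τ w) A G = G) (hfin : ∀ x, G x ≠ ⊤) :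
    ENNReal.ofReal p * G u ≤ killedOp σ A G u := by
  have hcomm : Function.Commute (killedOp σ A) (killedOp τ A) := killedOp_comm hcross
  set a := killedOp σ A with ha
  set b := killedOp τ A with hb
  have hH : ∀ j, a (b^[j] G) + b (b^[j] G) = b^[j] G := by
    intro j
    induction j with
    | zero =>
      rw [killedOp_weight_add hσ hτ] at hG
      exact hG
    | succ j ih =>
      rw [Function.iterate_succ_apply', hcomm (b^[j] G)]
      conv_rhs => rw [← ih]
      rw [hb, ← killedOp_add]
  have hble : ∀ j, b^[j] G ≤ G := by
    intro j
    induction j with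
    | zero => exact le_rfl
    | succ j ih =>
      rw [Function.iterate_succ_apply']
      refine le_trans ?_ ih
      conv_rhs => rw [← hH j]
      exact le_add_self
  have hale : ∀ j k, a^[k] (b^[j] G) ≤ b^[j] G := by
    intro j k
    induction k with
    | zero => exact le_rfl
    | succ k ih =>
      rw [Function.iterate_succ_apply']
      refine (killedOp_mono ih).trans ?_
      conv_rhs => rw [← hH j]
      exact le_self_add
  have hsfin : ∀ j k x, a^[k] (b^[j] G) x ≠ ⊤ := fun j k x =>
    ne_top_of_le_ne_top (hfin x) (((hale j k).trans (hble j)) x)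
  have hrec : ∀ j k, a^[k] (b^[j] G) = a^[k] (b^[j + 1] G) + a^[k + 1] (b^[j] G) := by
    intro j k
    conv_lhs => rw [← hH j]
    rw [iterate_killedOp_add, add_comm, ← Function.iterate_succ_apply' b,
      ← Function.iterate_succ_apply a]
  have main : ∀ q, 0 ≤ q → q < p → ENNReal.ofReal q * G u ≤ a G u := by
    intro q hq hqp
    obtain ⟨T, W, hWu, hTA, hWT, hW1, hWq⟩ := htest q hq hqp
    obtain ⟨c, hc0, hct, hc⟩ := exists_mul_le_on_finset_of_irred hirr hu T hTA
    have hWk : ∀ k x, ENNReal.ofReal q ^ k * W x ≤ a^[k] W x := by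
      intro k
      induction k with
      | zero => intro x; simp
      | succ k ih =>
        intro x
        rw [Function.iterate_succ_apply']
        have h1 : (fun x => ENNReal.ofReal q ^ k * W x) ≤ a^[k] W := ih
        have h2 := killedOp_mono (σ := σ) (A := A) h1 x
        rw [killedOp_const_mul] at h2
        refine le_trans ?_ h2
        rw [pow_succ, mul_assoc]
        exact mul_le_mul_right (hWq x) _
    have hlow : ∀ j k, c * W u * ENNReal.ofReal q ^ k * (b^[j] G) u ≤ a^[k] (b^[j] G) u := by
      intro j k
      have hle : (fun x => c * (b^[j] G) u * W x) ≤ b^[j] G := by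
        intro x
        by_cases hx : x ∈ T
        · refine le_trans ?_ (hc (b^[j] G) ?_ x hx)
          · exact mul_le_of_le_one_right zero_le (hW1 x)
          · rw [killedOp_weight_add hσ hτ]; exact hH j
        · simp [hWT x hx]
      have hit : ∀ k, a^[k] (fun x => c * (b^[j] G) u * W x)
          = fun x => c * (b^[j] G) u * a^[k] W x := by
        intro k
        induction k with
        | zero => rfl
        | succ k ih => rw [Function.iterate_succ_apply', ih, ha, killedOp_const_mul,
            ← ha, ← Function.iterate_succ_apply' a]
      have h1 := (killedOp_mono (σ := σ) (A := A)).iterate k hle u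
      rw [← ha, hit] at h1
      refine le_trans ?_ h1
      calc c * W u * ENNReal.ofReal q ^ k * (b^[j] G) u
          = c * (b^[j] G) u * (ENNReal.ofReal q ^ k * W u) := by ring
        _ ≤ _ := mul_le_mul_right (hWk k u) _
    have hWt : W u ≠ ⊤ := ne_top_of_le_ne_top ENNReal.one_ne_top (hW1 u)
    have := mul_le_of_array (fun j k => (a^[k] (b^[j] G) u).toReal)
      (fun j k => ENNReal.toReal_nonneg)
      (fun j k => by
        rw [← ENNReal.toReal_add (hsfin _ _ _) (hsfin _ _ _)]
        congr 1
        exact congrFun (hrec j k) u)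
      (C := (c * W u).toReal) (q := q)
      (ENNReal.toReal_pos (mul_ne_zero hc0 hWu) (ENNReal.mul_ne_top hct hWt)) hq
      (fun j k => by
        have := ENNReal.toReal_mono (hsfin j k u) (hlow j k)
        simpa only [ENNReal.toReal_mul, ENNReal.toReal_pow, ENNReal.toReal_ofReal hq,
          Function.iterate_zero, id_eq] using this)
    simp only [Function.iterate_zero, id_eq, Function.iterate_one] at this
    have h3 := ENNReal.ofReal_le_ofReal this
    rwa [ENNReal.ofReal_mul hq, ENNReal.ofReal_toReal (hfin u),
      ENNReal.ofReal_toReal (show a G u ≠ ⊤ from hsfin 0 1 u)] at h3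
  rcases le_or_gt p 0 with hp | hp
  · rw [ENNReal.ofReal_of_nonpos hp, zero_mul]; exact zero_le
  · have hle : ∀ᶠ q in 𝓝[<] p, ENNReal.ofReal q * G u ≤ a G u := by
      filter_upwards [Ioo_mem_nhdsLT hp] with q hq using main q hq.1.le hq.2
    refine le_of_tendsto ?_ hle
    refine ENNReal.Tendsto.mul_const ?_ (Or.inr (hfin u))
    exact (ENNReal.continuous_ofReal.tendsto p).mono_left nhdsWithin_le_nhds

end KilledOperator

section AxisWalk

open scoped ENNReal

/-- Centered step laws on `ℤ^m` with exponential moments, only one coordinate changing at a time,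
for which the walk killed outside the positive orthant is irreducible. -/
structure AxisLaw {m : ℕ} (ν : (Fin m → ℤ) → ℝ) : Prop where
  nonneg : ∀ u, 0 ≤ ν u
  hasSum : HasSum ν 1
  irred : Irred ν posAll
  exp_moment : ∃ ε : ℝ, 0 < ε ∧ ∀ α : Fin m → ℝ, rnorm α < ε →
    Summable (fun u : Fin m → ℤ => ν u * Real.exp (∑ i, α i * (u i : ℝ)))
  mean : ∀ i : Fin m, HasSum (fun u : Fin m → ℤ => ν u * (u i : ℝ)) 0
  axis : ∀ u : Fin m → ℤ, (∃ i j : Fin m, i ≠ j ∧ u i ≠ 0 ∧ u j ≠ 0) → ν u = 0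

variable {m : ℕ} {ν : (Fin m → ℤ) → ℝ}

/-- The part of `ν` that moves the `i`-th coordinate. -/
noncomputable def axisWeight (ν : (Fin m → ℤ) → ℝ) (i : Fin m) (w : Fin m → ℤ) : ℝ :=
  if w i = 0 then 0 else ν w

/-- The part of `ν` that leaves the `i`-th coordinate unchanged. -/
noncomputable def offAxisWeight (ν : (Fin m → ℤ) → ℝ) (i : Fin m) (w : Fin m → ℤ) : ℝ :=
  if w i = 0 then ν w else 0

/-- The law of the jumps of the `i`-th coordinate. -/
noncomputable def axisLaw (ν : (Fin m → ℤ) → ℝ) (i : Fin m) (k : ℤ) : ℝ :=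
  axisWeight ν i (Pi.single i k)

theorem axisWeight_add_offAxisWeight (ν : (Fin m → ℤ) → ℝ) (i : Fin m) :
    (fun w => axisWeight ν i w + offAxisWeight ν i w) = ν := by
  funext w
  unfold axisWeight offAxisWeight
  split_ifs <;> simp

theorem AxisLaw.axisWeight_nonneg (hν : AxisLaw ν) (i : Fin m) (w : Fin m → ℤ) :
    0 ≤ axisWeight ν i w := by
  unfold axisWeight
  split_ifs
  · exact le_rfl
  · exact hν.nonneg w

theorem AxisLaw.offAxisWeight_nonneg (hν : AxisLaw ν) (i : Fin m) (w : Fin m → ℤ) :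
    0 ≤ offAxisWeight ν i w := by
  unfold offAxisWeight
  split_ifs
  · exact hν.nonneg w
  · exact le_rfl

theorem AxisLaw.eq_single (hν : AxisLaw ν) {w : Fin m → ℤ} (hw : ν w ≠ 0) {i : Fin m}
    (hi : w i ≠ 0) : w = Pi.single i (w i) := by
  funext j
  by_cases hj : j = i
  · subst hj; rw [Pi.single_eq_same]
  · rw [Pi.single_eq_of_ne hj]
    by_contra h
    exact hw (hν.axis w ⟨i, j, Ne.symm hj, hi, h⟩)

theorem AxisLaw.eq_single_of_axisWeight (hν : AxisLaw ν) {w : Fin m → ℤ} {i : Fin m}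
    (hw : axisWeight ν i w ≠ 0) : w = Pi.single i (w i) := by
  unfold axisWeight at hw
  split_ifs at hw with h
  · exact absurd rfl hw
  · exact hν.eq_single hw h

theorem AxisLaw.hasSum_axisLaw_iff (hν : AxisLaw ν) (i : Fin m) (φ : (Fin m → ℤ) → ℝ) (s : ℝ) :
    HasSum (fun k : ℤ => axisLaw ν i k * φ (Pi.single i k)) s ↔
      HasSum (fun w => axisWeight ν i w * φ w) s := by
  refine (Pi.single_injective (M := fun _ => ℤ) i).hasSum_iff
    (f := fun w => axisWeight ν i w * φ w) ?_
  intro w hw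
  by_cases h : axisWeight ν i w = 0
  · rw [h, zero_mul]
  · exact absurd ⟨w i, (hν.eq_single_of_axisWeight h).symm⟩ hw

theorem AxisLaw.axisWeight_mul_eq (ν : (Fin m → ℤ) → ℝ) (i : Fin m) (w : Fin m → ℤ) :
    axisWeight ν i w * (w i : ℝ) = ν w * (w i : ℝ) := by
  unfold axisWeight
  split_ifs with h
  · simp [h]
  · rfl

theorem AxisLaw.axisWeight_le (hν : AxisLaw ν) (i : Fin m) (w : Fin m → ℤ) :
    axisWeight ν i w ≤ ν w := by
  unfold axisWeight
  split_ifs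
  · exact hν.nonneg w
  · exact le_rfl

theorem AxisLaw.reflTransGen (hν : AxisLaw ν) (i : Fin m) (x y : ℤ) (hx : 0 < x) (hy : 0 < y) :
    Relation.ReflTransGen (HalfLineStep (axisLaw ν i)) x y := by
  have hmem : ∀ z : ℤ, 0 < z → Function.update (1 : Fin m → ℤ) i z ∈ (posAll : Set (Fin m → ℤ)) := by
    intro z hz j
    by_cases hj : j = i
    · subst hj; simpa using hz
    · simp [hj]
  obtain ⟨k, c, h0, hk, hA, hstep⟩ := hν.irred _ (hmem x hx) _ (hmem y hy)
  have key : ∀ j ≤ k, Relation.ReflTransGen (HalfLineStep (axisLaw ν i)) (c 0 i) (c j i) := by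
    intro j hj
    induction j with
    | zero => exact .refl
    | succ j ih =>
      have ih := ih (by omega)
      by_cases he : c (j + 1) i = c j i
      · rwa [he]
      · refine ih.tail ⟨hA j (by omega) i, hA (j + 1) hj i, ?_⟩
        have hpos := hstep j (by omega)
        have hi : (c (j + 1) - c j) i ≠ 0 := by rw [Pi.sub_apply]; omega
        have := hν.eq_single hpos.ne' hi
        rw [axisLaw, ← Pi.sub_apply, ← this, axisWeight, if_neg hi]
        exact hpos
  simpa [h0, hk] using key k le_rfl

theorem AxisLaw.centeredLaw (hν : AxisLaw ν) (i : Fin m) :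
    ∃ θ, CenteredLaw (axisLaw ν i) θ := by
  obtain ⟨ε, hε, H⟩ := hν.exp_moment
  have hrn : ∀ t : ℝ, |t| < ε → Summable fun w : Fin m → ℤ => ν w * Real.exp (t * (w i : ℝ)) := by
    intro t ht
    have := H (Pi.single i t) ?_
    · refine this.congr fun w => ?_
      congr 2
      rw [Finset.sum_eq_single i]
      · rw [Pi.single_eq_same]
      · intro j _ hj; rw [Pi.single_eq_of_ne hj, zero_mul]
      · simp
    · unfold rnorm
      rw [Finset.sum_eq_single i]
      · rwa [Pi.single_eq_same]
      · intro j _ hj; rw [Pi.single_eq_of_ne hj, abs_zero]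
      · simp
  refine ⟨ε / 4, by positivity, fun k => hν.axisWeight_nonneg i _, ?_, ?_, ?_⟩
  · have := (hν.hasSum_axisLaw_iff i (fun w => (w i : ℝ)) 0).2
      ((hν.mean i).congr_fun fun w => AxisLaw.axisWeight_mul_eq ν i w)
    simpa only [Pi.single_eq_same] using this
  · have h1 := hrn (ε / 2) (by rw [abs_of_pos] <;> linarith)
    have h2 := hrn (-(ε / 2)) (by rw [abs_neg, abs_of_pos] <;> linarith)
    have h3 : Summable fun w : Fin m → ℤ =>
        axisWeight ν i w * Real.exp (2 * (ε / 4) * |(w i : ℝ)|) := by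
      refine Summable.of_nonneg_of_le
        (fun w => mul_nonneg (hν.axisWeight_nonneg i w) (Real.exp_pos _).le) (fun w => ?_)
        (h1.add h2)
      rw [← mul_add]
      refine mul_le_mul (hν.axisWeight_le i w) ?_ (Real.exp_pos _).le (hν.nonneg w)
      rcases abs_cases (w i : ℝ) with ⟨h, _⟩ | ⟨h, _⟩
      · rw [h, show 2 * (ε / 4) * (w i : ℝ) = ε / 2 * w i by ring]
        linarith [Real.exp_pos (-(ε / 2) * (w i : ℝ))]
      · rw [h, show 2 * (ε / 4) * -(w i : ℝ) = -(ε / 2) * w i by ring]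
        linarith [Real.exp_pos (ε / 2 * (w i : ℝ))]
    have := ((hν.hasSum_axisLaw_iff i
      (fun w => Real.exp (2 * (ε / 4) * |(w i : ℝ)|)) _).2 h3.hasSum).summable
    simpa only [Pi.single_eq_same] using this
  · rcases (hν.reflTransGen i 1 2 one_pos two_pos).cases_head with h | ⟨y, ⟨_, _, h⟩, _⟩
    · omega
    · refine ⟨y - 1, fun h0 => ?_, h⟩
      rw [h0] at h
      simp [axisLaw, axisWeight] at h

theorem ofReal_tsum_le_tsum_ofReal {ι : Type*} {f : ι → ℝ} {s : ℝ} (hf : HasSum f s) :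
    ENNReal.ofReal s ≤ ∑' w, ENNReal.ofReal (f w) := by
  have hp : Summable fun w => max (f w) 0 :=
    hf.summable.abs.of_nonneg_of_le (fun w => le_max_right _ _)
      (fun w => max_le (le_abs_self _) (abs_nonneg _))
  have h1 : s ≤ ∑' w, max (f w) 0 := hasSum_le (fun w => le_max_left _ _) hf hp.hasSum
  refine (ENNReal.ofReal_le_ofReal h1).trans ?_
  rw [ENNReal.ofReal_tsum_of_nonneg (fun w => le_max_right _ _) hp]
  exact ENNReal.tsum_le_tsum fun w => by
    rcases le_total (f w) 0 with h | h
    · rw [max_eq_right h, ENNReal.ofReal_zero]; exact zero_le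
    · rw [max_eq_left h]

/-- A parabola on a coordinate line is an almost eigenfunction of the coordinate walk. -/
theorem AxisLaw.exists_test (hν : AxisLaw ν) (i : Fin m) {u : Fin m → ℤ}
    (hu : u ∈ (posAll : Set (Fin m → ℤ))) {q : ℝ} (hq : q < ∑' w, axisWeight ν i w) :
    ∃ (T : Finset (Fin m → ℤ)) (W : (Fin m → ℤ) → ℝ≥0∞), W u ≠ 0 ∧
      (∀ y ∈ T, y ∈ (posAll : Set (Fin m → ℤ))) ∧ (∀ y, y ∉ T → W y = 0) ∧ (∀ y, W y ≤ 1) ∧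
      ∀ x, ENNReal.ofReal q * W x ≤ killedOp (axisWeight ν i) posAll W x := by
  obtain ⟨θ, hμ⟩ := hν.centeredLaw i
  have hθ := hμ.theta_pos
  set p := ∑' w, axisWeight ν i w with hp
  have hsum0 : HasSum (axisWeight ν i) p :=
    (hν.hasSum.summable.of_nonneg_of_le (hν.axisWeight_nonneg i) (hν.axisWeight_le i)).hasSum
  have hsum1 : HasSum (fun w => axisWeight ν i w * (w i : ℝ)) 0 :=
    (hν.mean i).congr_fun fun w => AxisLaw.axisWeight_mul_eq ν i w
  obtain ⟨S, hsum2⟩ : ∃ S, HasSum (fun w => axisWeight ν i w * (w i : ℝ) ^ 2) S := by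
    have h2 : Summable fun k : ℤ => axisLaw ν i k * ((k : ℝ) ^ 2) := by
      refine hμ.summable_mul (C := 1 / θ ^ 2) fun k => ?_
      have h1 : θ * |(k : ℝ)| ≤ Real.exp (θ * |(k : ℝ)|) :=
        (by linarith : θ * |(k : ℝ)| ≤ θ * |(k : ℝ)| + 1).trans (Real.add_one_le_exp _)
      have h2 : (θ * |(k : ℝ)|) ^ 2 ≤ Real.exp (2 * θ * |(k : ℝ)|) := by
        rw [show 2 * θ * |(k : ℝ)| = θ * |(k : ℝ)| + θ * |(k : ℝ)| by ring, Real.exp_add, sq]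
        exact mul_self_le_mul_self (by positivity) h1
      rw [abs_of_nonneg (sq_nonneg _), div_mul_eq_mul_div, one_mul, le_div_iff₀ (by positivity)]
      rw [mul_pow, sq_abs] at h2
      linarith
    refine ⟨∑' k : ℤ, axisLaw ν i k * ((k : ℝ) ^ 2),
      (hν.hasSum_axisLaw_iff i (fun w => (w i : ℝ) ^ 2) _).1 ?_⟩
    simpa only [Pi.single_eq_same] using h2.hasSum
  have hS : 0 ≤ S := hsum2.nonneg fun w => mul_nonneg (hν.axisWeight_nonneg i w) (sq_nonneg _)
  obtain ⟨N, hN⟩ : ∃ N : ℤ, u i < N ∧ S ≤ (p - q) * (N - 1) := by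
    obtain ⟨n, hn⟩ := exists_int_gt (S / (p - q) + 1)
    refine ⟨max n (u i + 1), by omega, ?_⟩
    have h1 : (n : ℝ) ≤ (max n (u i + 1) : ℤ) := by exact_mod_cast le_max_left _ _
    have h2 : S / (p - q) ≤ (max n (u i + 1) : ℤ) - 1 := by linarith
    rw [div_le_iff₀ (by linarith)] at h2
    linarith
  obtain ⟨huN, hNS⟩ := hN
  have hui : 0 < u i := hu i
  have hNpos : (0 : ℝ) < N := by exact_mod_cast hui.trans huN
  set P : ℤ → ℝ := fun k => (k : ℝ) * (N - k) / N ^ 2 with hP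
  have hPle : ∀ k, P k ≤ 1 := fun k => by
    simp only [hP]
    rw [div_le_one (by positivity)]
    nlinarith [sq_nonneg ((k : ℝ)), sq_nonneg ((k : ℝ) - N)]
  have hPnonpos : ∀ k : ℤ, ¬ (1 ≤ k ∧ k ≤ N - 1) → P k ≤ 0 := fun k hk => by
    simp only [hP]
    refine div_nonpos_of_nonpos_of_nonneg ?_ (by positivity)
    by_cases h : k ≤ 0
    · have h' : (k : ℝ) ≤ 0 := by exact_mod_cast h
      exact mul_nonpos_of_nonpos_of_nonneg h' (by linarith)
    · have h1 : (0 : ℝ) ≤ k := by exact_mod_cast (by omega : (0 : ℤ) ≤ k)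
      have h2 : (N : ℝ) ≤ k := by exact_mod_cast (by omega : N ≤ k)
      exact mul_nonpos_of_nonneg_of_nonpos h1 (by linarith)
  set W : (Fin m → ℤ) → ℝ≥0∞ := fun v =>
    if Function.update u i (v i) = v then ENNReal.ofReal (P (v i)) else 0 with hW
  have hWupd : ∀ k, W (Function.update u i k) = ENNReal.ofReal (P k) := fun k => by
    simp [hW]
  set T : Finset (Fin m → ℤ) := (Finset.Icc 1 (N - 1)).image (Function.update u i) with hT
  have hupdA : ∀ k : ℤ, 0 < k → Function.update u i k ∈ (posAll : Set (Fin m → ℤ)) := by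
    intro k hk j
    by_cases hj : j = i
    · subst hj; simpa using hk
    · simpa [hj] using hu j
  have hWT : ∀ y, y ∉ T → W y = 0 := by
    intro y hy
    simp only [hW]
    split_ifs with h
    · refine ENNReal.ofReal_of_nonpos (hPnonpos _ fun h' => hy ?_)
      rw [hT, Finset.mem_image]
      exact ⟨y i, Finset.mem_Icc.2 h', h⟩
    · rfl
  refine ⟨T, W, ?_, ?_, hWT, ?_, ?_⟩
  · have := hWupd (u i)
    rw [Function.update_eq_self] at this
    rw [this, Ne, ENNReal.ofReal_eq_zero, not_le]
    have h1 : (0 : ℝ) < u i := by exact_mod_cast hui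
    have h2 : (0 : ℝ) < N - u i := by have : (u i : ℝ) < N := by exact_mod_cast huN
                                      linarith
    simp only [hP]
    positivity
  · intro y hy
    obtain ⟨k, hk, rfl⟩ := Finset.mem_image.1 hy
    exact hupdA k (by have := (Finset.mem_Icc.1 hk).1; omega)
  · intro y
    simp only [hW]
    split_ifs
    · exact ENNReal.ofReal_le_one.2 (hPle _)
    · exact zero_le
  · intro x
    by_cases hx : x ∈ T
    swap
    · rw [hWT x hx, mul_zero]; exact zero_le
    obtain ⟨k, hk, rfl⟩ := Finset.mem_image.1 hx
    rw [Finset.mem_Icc] at hk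
    rw [killedOp_of_mem _ (hupdA k (by omega)), hWupd]
    have hs : HasSum (fun w => axisWeight ν i w * P (k + w i))
        (p * P k + (N - 2 * k) / N ^ 2 * 0 - 1 / N ^ 2 * S) := by
      refine ((((hsum0.mul_right (P k)).add (hsum1.mul_left ((N - 2 * k) / (N : ℝ) ^ 2))).sub
        (hsum2.mul_left (1 / (N : ℝ) ^ 2)))).congr_fun fun w => ?_
      simp only [hP]; push_cast; field_simp; ring
    have hqP : q * P k ≤ p * P k + (N - 2 * k) / N ^ 2 * 0 - 1 / N ^ 2 * S := by
      have h1 : (1 : ℝ) ≤ k := by exact_mod_cast hk.1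
      have h2 : (1 : ℝ) ≤ N - k := by have : (k : ℝ) ≤ N - 1 := by exact_mod_cast hk.2
                                      linarith
      have h3 : (N : ℝ) - 1 ≤ k * (N - k) := by nlinarith
      have h4 : S ≤ (p - q) * (k * (N - k)) :=
        hNS.trans (mul_le_mul_of_nonneg_left h3 (by linarith))
      have h5 : 1 / (N : ℝ) ^ 2 * S ≤ (p - q) * P k := by
        simp only [hP]
        rw [← mul_div_assoc, one_div, ← div_eq_inv_mul]
        gcongr
      linarith
    have hPk : 0 ≤ P k := by
      have h1 : (1 : ℝ) ≤ k := by exact_mod_cast hk.1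
      have h2 : (1 : ℝ) ≤ N - k := by have : (k : ℝ) ≤ N - 1 := by exact_mod_cast hk.2
                                      linarith
      simp only [hP]
      positivity
    rw [← ENNReal.ofReal_mul' hPk]
    refine (ENNReal.ofReal_le_ofReal hqP).trans ((ofReal_tsum_le_tsum_ofReal hs).trans ?_)
    refine ENNReal.tsum_le_tsum fun w => ?_
    rw [ENNReal.ofReal_mul (hν.axisWeight_nonneg i w)]
    by_cases hw : axisWeight ν i w = 0
    · simp [hw]
    · have hadd : Function.update u i k + w = Function.update u i (k + w i) := by
        conv_lhs => rw [hν.eq_single_of_axisWeight hw]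
        funext j
        by_cases hj : j = i
        · subst hj; simp
        · simp [hj]
      rw [hadd]
      refine mul_le_mul_right ?_ _
      by_cases hA : Function.update u i (k + w i) ∈ (posAll : Set (Fin m → ℤ))
      · rw [if_pos hA, hWupd]
      · rw [if_neg hA, ENNReal.ofReal_of_nonpos]
        refine hPnonpos _ fun h' => hA (hupdA _ (by omega))

end AxisWalk

section CoordinateHarmonicity

open scoped ENNReal

theorem HarmOn.hasSum {V : Type*} [AddCommGroup V] {ν : V → ℝ} {A : Set V} {g : V → ℝ}
    (hpos : ∀ x ∈ A, 0 < g x) (hg : HarmOn ν A g) {x : V} (hx : x ∈ A) :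
    HasSum (fun w => ν w * A.indicator g (x + w)) (g x) := by
  have h1 := hg x hx
  have hs : Summable fun y : V => if y ∈ A then ν (y - x) * g y else 0 := by
    by_contra h
    rw [tsum_eq_zero_of_not_summable h] at h1
    exact (hpos x hx).ne' h1
  have h2 := hs.hasSum
  rw [← h1] at h2
  refine ((Equiv.addLeft x).hasSum_iff.2 h2).congr_fun fun w => ?_
  simp only [Function.comp, Equiv.coe_addLeft, add_sub_cancel_left, Set.indicator]
  split_ifs <;> simp

theorem killedOp_eq_of_harmOn {V : Type*} [AddCommGroup V] {ν : V → ℝ} {A : Set V} {g : V → ℝ}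
    (hν : ∀ w, 0 ≤ ν w) (hpos : ∀ x ∈ A, 0 < g x) (hg : HarmOn ν A g) :
    killedOp ν A (fun x => ENNReal.ofReal (A.indicator g x))
      = fun x => ENNReal.ofReal (A.indicator g x) := by
  have hnn : ∀ x, 0 ≤ A.indicator g x := fun x =>
    Set.indicator_nonneg (fun y hy => (hpos y hy).le) x
  funext x
  by_cases hx : x ∈ A
  · have h := HarmOn.hasSum hpos hg hx
    rw [killedOp_of_mem _ hx, Set.indicator_of_mem hx, ← h.tsum_eq,
      ENNReal.ofReal_tsum_of_nonneg (fun w => mul_nonneg (hν w) (hnn _)) h.summable]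
    refine tsum_congr fun w => ?_
    rw [ENNReal.ofReal_mul (hν w)]
    congr 1
    split_ifs with hw
    · rfl
    · rw [Set.indicator_of_notMem hw, ENNReal.ofReal_zero]
  · rw [killedOp_of_notMem _ hx, Set.indicator_of_notMem hx, ENNReal.ofReal_zero]

theorem harmOn_toReal_of_killedOp_eq {V : Type*} [AddCommGroup V] {ν : V → ℝ} {A : Set V}
    (hν : ∀ w, 0 ≤ ν w) {G : V → ℝ≥0∞} (hfin : ∀ x, G x ≠ ⊤) (hG : killedOp ν A G = G) :
    HarmOn ν A (fun x => (G x).toReal) := by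
  intro x hx
  have h1 : G x = ∑' w, ENNReal.ofReal (ν w) * (if x + w ∈ A then G (x + w) else 0) := by
    conv_lhs => rw [← hG, killedOp_of_mem _ hx]
  beta_reduce
  rw [h1, ENNReal.tsum_toReal_eq]
  · rw [← (Equiv.addLeft x).tsum_eq (fun y => if y ∈ A then ν (y - x) * (G y).toReal else 0)]
    refine tsum_congr fun w => ?_
    rw [ENNReal.toReal_mul, ENNReal.toReal_ofReal (hν w)]
    simp only [Equiv.coe_addLeft, add_sub_cancel_left]
    split_ifs <;> simp
  · intro w
    refine ENNReal.mul_ne_top ENNReal.ofReal_ne_top ?_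
    split_ifs
    · exact hfin _
    · exact ENNReal.zero_ne_top

variable {m : ℕ} {ν : (Fin m → ℤ) → ℝ} {g : (Fin m → ℤ) → ℝ}

theorem AxisLaw.cross (hν : AxisLaw ν) (i : Fin m) :
    ∀ x ∈ (posAll : Set (Fin m → ℤ)), ∀ w v, axisWeight ν i w ≠ 0 → offAxisWeight ν i v ≠ 0 →
      x + w + v ∈ (posAll : Set (Fin m → ℤ)) →
      x + w ∈ (posAll : Set (Fin m → ℤ)) ∧ x + v ∈ (posAll : Set (Fin m → ℤ)) := by
  intro x hx w v hw hv h
  have hvi : v i = 0 := by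
    by_contra h'
    exact hv (if_neg h')
  have hwj : ∀ j, j ≠ i → w j = 0 := fun j hj => by
    rw [hν.eq_single_of_axisWeight hw, Pi.single_eq_of_ne hj]
  refine ⟨fun j => ?_, fun j => ?_⟩
  · have h1 := h j
    have h2 := hx j
    simp only [Pi.add_apply] at h1 ⊢
    by_cases hj : j = i
    · subst hj; omega
    · have := hwj j hj; omega
  · have h1 := h j
    have h2 := hx j
    simp only [Pi.add_apply] at h1 ⊢
    by_cases hj : j = i
    · subst hj; omega
    · have := hwj j hj; omega

theorem AxisLaw.hasSum_axisWeight (hν : AxisLaw ν) (i : Fin m) :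
    HasSum (axisWeight ν i) (∑' w, axisWeight ν i w) :=
  (hν.hasSum.summable.of_nonneg_of_le (hν.axisWeight_nonneg i) (hν.axisWeight_le i)).hasSum

/-- Positive harmonic functions are subharmonic along every coordinate. -/
theorem AxisLaw.exists_hasSum_ge (hν : AxisLaw ν)
    (hpos : ∀ x ∈ (posAll : Set (Fin m → ℤ)), 0 < g x) (hg : HarmOn ν posAll g) (i : Fin m)
    {u : Fin m → ℤ} (hu : u ∈ (posAll : Set (Fin m → ℤ))) :
    ∃ s, (∑' w, axisWeight ν i w) * g u ≤ s ∧
      HasSum (fun w => axisWeight ν i w * posAll.indicator g (u + w)) s := by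
  have hnn : ∀ x, 0 ≤ (posAll : Set (Fin m → ℤ)).indicator g x := fun x =>
    Set.indicator_nonneg (fun y hy => (hpos y hy).le) x
  have hp : 0 ≤ ∑' w, axisWeight ν i w := tsum_nonneg (hν.axisWeight_nonneg i)
  have hs : Summable fun w => axisWeight ν i w * (posAll : Set (Fin m → ℤ)).indicator g (u + w) :=
    (HarmOn.hasSum hpos hg hu).summable.of_nonneg_of_le
      (fun w => mul_nonneg (hν.axisWeight_nonneg i w) (hnn _))
      (fun w => mul_le_mul_of_nonneg_right (hν.axisWeight_le i w) (hnn _))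
  refine ⟨_, ?_, hs.hasSum⟩
  have hadd := axisWeight_add_offAxisWeight ν i
  have h := mul_le_killedOp_of_test (A := posAll) (hν.axisWeight_nonneg i)
    (hν.offAxisWeight_nonneg i) (by rw [hadd]; exact hν.irred) (hν.cross i) hu
    (fun q _ hq => hν.exists_test i hu hq)
    (G := fun x => ENNReal.ofReal ((posAll : Set (Fin m → ℤ)).indicator g x))
    (by rw [hadd]; exact killedOp_eq_of_harmOn hν.nonneg hpos hg)
    (fun x => ENNReal.ofReal_ne_top)
  rw [killedOp_of_mem _ hu, ← ENNReal.ofReal_mul hp, Set.indicator_of_mem hu] at h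
  rw [← ENNReal.ofReal_le_ofReal_iff
    (tsum_nonneg fun w => mul_nonneg (hν.axisWeight_nonneg i w) (hnn _))]
  refine h.trans (le_of_eq ?_)
  rw [ENNReal.ofReal_tsum_of_nonneg
    (fun w => mul_nonneg (hν.axisWeight_nonneg i w) (hnn _)) hs]
  refine tsum_congr fun w => ?_
  rw [ENNReal.ofReal_mul (hν.axisWeight_nonneg i w)]
  congr 1
  split_ifs with hw
  · rfl
  · rw [Set.indicator_of_notMem hw, ENNReal.ofReal_zero]

theorem AxisLaw.sum_axisWeight (hν : AxisLaw ν) {w : Fin m → ℤ} (hw : w ≠ 0) :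
    ∑ i, axisWeight ν i w = ν w := by
  obtain ⟨i, hi⟩ := Function.ne_iff.1 hw
  by_cases h : ν w = 0
  · rw [h]
    exact Finset.sum_eq_zero fun j _ => by unfold axisWeight; rw [h, ite_self]
  · rw [Finset.sum_eq_single i]
    · exact if_neg hi
    · intro j _ hj
      refine if_pos ?_
      rw [hν.eq_single h hi, Pi.single_eq_of_ne hj]
    · simp

theorem AxisLaw.mul_eq_sum (hν : AxisLaw ν) (φ : (Fin m → ℤ) → ℝ) (hφ : φ 0 = 0)
    (w : Fin m → ℤ) : ν w * φ w = ∑ i, axisWeight ν i w * φ w := by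
  by_cases hw : w = 0
  · subst hw; simp [hφ]
  · rw [← Finset.sum_mul, hν.sum_axisWeight hw]

/-- Positive harmonic functions are harmonic along every coordinate. -/
theorem AxisLaw.hasSum_axisWeight_mul (hν : AxisLaw ν)
    (hpos : ∀ x ∈ (posAll : Set (Fin m → ℤ)), 0 < g x) (hg : HarmOn ν posAll g) (i : Fin m)
    {u : Fin m → ℤ} (hu : u ∈ (posAll : Set (Fin m → ℤ))) :
    HasSum (fun w => axisWeight ν i w * posAll.indicator g (u + w))
      ((∑' w, axisWeight ν i w) * g u) := by
  choose s hs hsum using fun j => hν.exists_hasSum_ge hpos hg j hu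
  have h1 := (HarmOn.hasSum hpos hg hu).sub (hν.hasSum.mul_right (g u))
  have h2 := hasSum_sum (s := Finset.univ) fun j (_ : j ∈ Finset.univ) =>
    (hsum j).sub ((hν.hasSum_axisWeight j).mul_right (g u))
  have h3 : ∑ j, (s j - (∑' w, axisWeight ν j w) * g u) = g u - 1 * g u := by
    refine h2.unique (h1.congr_fun fun w => ?_)
    have := hν.mul_eq_sum
      (fun w => (posAll : Set (Fin m → ℤ)).indicator g (u + w) - g u)
      (by simp [Set.indicator_of_mem hu]) w
    simp only [mul_sub] at this ⊢
    exact this.symm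
  rw [one_mul, sub_self, Finset.sum_eq_zero_iff_of_nonneg fun j _ => sub_nonneg.2 (hs j)] at h3
  have := h3 i (Finset.mem_univ i)
  rw [sub_eq_zero] at this
  rw [← this]
  exact hsum i

theorem AxisLaw.halfLineHarmonic (hν : AxisLaw ν)
    (hpos : ∀ x ∈ (posAll : Set (Fin m → ℤ)), 0 < g x) (hg : HarmOn ν posAll g) (i : Fin m)
    {u : Fin m → ℤ} (hu : u ∈ (posAll : Set (Fin m → ℤ))) :
    HalfLineHarmonic (axisLaw ν i)
      (fun x => (posAll : Set (Fin m → ℤ)).indicator g (Function.update u i x)) := by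
  refine ⟨fun x => Set.indicator_nonneg (fun y hy => (hpos y hy).le) _, fun x hx => ?_,
    fun x hx => ?_⟩
  · refine Set.indicator_of_notMem (fun h => ?_) _
    have := h i
    rw [Function.update_self] at this
    omega
  · have hmem : Function.update u i x ∈ (posAll : Set (Fin m → ℤ)) := by
      intro j
      by_cases hj : j = i
      · subst hj; simpa using hx
      · simpa [hj] using hu j
    have h1 := (hν.hasSum_axisLaw_iff i _ _).2 (hν.hasSum_axisWeight_mul hpos hg i hmem)
    have h2 : ∑' k, axisLaw ν i k = ∑' w, axisWeight ν i w := by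
      have := (hν.hasSum_axisLaw_iff i (fun _ => 1) _).2
        ((hν.hasSum_axisWeight i).congr_fun fun w => mul_one _)
      simp only [mul_one] at this
      exact this.tsum_eq
    rw [h2, Set.indicator_of_mem hmem]
    refine ((Equiv.subRight x).hasSum_iff.2 h1).congr_fun fun y => ?_
    simp only [Function.comp, Equiv.subRight_apply]
    congr 2
    funext j
    by_cases hj : j = i
    · subst hj; simp
    · simp [hj]

end CoordinateHarmonicity

section ProductHarmonic

open scoped ENNReal

/-- A concave perturbation of the identity, superharmonic far from the origin. -/
noncomputable def linCorrected (θ : ℝ) (x : ℤ) : ℝ :=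
  if 0 < x then x + 1 - Real.exp (-θ * x) else 0

theorem linCorrected_nonneg {θ : ℝ} (hθ : 0 < θ) (x : ℤ) : 0 ≤ linCorrected θ x := by
  unfold linCorrected
  split_ifs with hx
  · have hx' : (0 : ℝ) < x := by exact_mod_cast hx
    have : Real.exp (-θ * x) ≤ 1 := Real.exp_le_one_iff.2 (by nlinarith)
    linarith
  · exact le_rfl

theorem le_linCorrected {θ : ℝ} (hθ : 0 < θ) {x : ℤ} (hx : 0 < x) : (x : ℝ) ≤ linCorrected θ x := by
  rw [linCorrected, if_pos hx]
  have hx' : (0 : ℝ) < x := by exact_mod_cast hx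
  have : Real.exp (-θ * x) ≤ 1 := Real.exp_le_one_iff.2 (by nlinarith)
  linarith

theorem linCorrected_le (θ : ℝ) (x : ℤ) : linCorrected θ x ≤ |(x : ℝ)| + 1 := by
  unfold linCorrected
  split_ifs
  · linarith [Real.exp_pos (-θ * x), le_abs_self (x : ℝ)]
  · positivity

theorem linCorrected_le_add_exp {θ : ℝ} (hθ : 0 < θ) (x : ℤ) :
    linCorrected θ x ≤ x + 1 - Real.exp (-θ * x) + (1 + 1 / θ) * Real.exp (-2 * θ * x) := by
  unfold linCorrected
  split_ifs with hx
  · have : 0 < (1 + 1 / θ) * Real.exp (-2 * θ * x) := by positivity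
    linarith
  · have hx' : (x : ℝ) ≤ 0 := by exact_mod_cast not_lt.1 hx
    have h1 : Real.exp (-θ * x) ≤ Real.exp (-2 * θ * x) := Real.exp_le_exp.2 (by nlinarith)
    have h2 : -θ * x ≤ Real.exp (-θ * x) := by linarith [Real.add_one_le_exp (-θ * (x : ℝ))]
    have h3 : -(x : ℝ) ≤ 1 / θ * Real.exp (-2 * θ * x) := by
      rw [one_div, ← div_eq_inv_mul, le_div_iff₀ hθ]
      linarith
    linarith

theorem CenteredLaw.exists_superharmonic {μ : ℤ → ℝ} {θ : ℝ} (hμ : CenteredLaw μ θ) :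
    ∃ L : ℤ → ℝ, (∀ x, 0 ≤ L x) ∧ (∀ x : ℤ, 0 < x → (x : ℝ) ≤ L x) ∧
      ∀ x : ℤ, 0 < x → ∃ d ≤ 0, HasSum (fun k => μ k * (L (x + k) - L x)) d := by
  have hθ := hμ.theta_pos
  obtain ⟨K, hK, H⟩ := hμ.neg.exists_exp_correction (1 + 1 / θ)
  refine ⟨fun x => linCorrected θ (x + K), fun x => linCorrected_nonneg hθ _, fun x hx => ?_,
    fun x hx => ?_⟩
  · refine le_trans ?_ (le_linCorrected hθ (by omega))
    have : (0 : ℝ) < K := by exact_mod_cast hK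
    push_cast; linarith
  · set z := x + K with hz
    have hz0 : 0 < z := by omega
    have hs : Summable fun k : ℤ => μ (-k) * (linCorrected θ (z - k) - linCorrected θ z) := by
      refine hμ.neg.summable_mul (1 / θ + (2 * |(z : ℝ)| + 2)) fun k => ?_
      have h1 := linCorrected_le θ (z - k)
      have h2 := linCorrected_le θ z
      have h3 := linCorrected_nonneg hθ (z - k)
      have h4 := linCorrected_nonneg hθ z
      have h5 : |((z - k : ℤ) : ℝ)| ≤ |(z : ℝ)| + |(k : ℝ)| := by push_cast; exact abs_sub _ _
      have h6 := Real.add_one_le_exp (2 * θ * |(k : ℝ)|)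
      have h7 : |(k : ℝ)| ≤ 1 / θ * Real.exp (2 * θ * |(k : ℝ)|) := by
        rw [one_div, ← div_eq_inv_mul, le_div_iff₀ hθ]
        nlinarith [abs_nonneg (k : ℝ)]
      have h8 : (2 * |(z : ℝ)| + 2) * 1 ≤ (2 * |(z : ℝ)| + 2) * Real.exp (2 * θ * |(k : ℝ)|) := by
        refine mul_le_mul_of_nonneg_left ?_ (by positivity)
        have : 0 ≤ 2 * θ * |(k : ℝ)| := by positivity
        linarith
      rw [abs_le]
      have := abs_nonneg (z : ℝ)
      have := abs_nonneg (k : ℝ)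
      constructor <;> linarith
    obtain ⟨d, hd, hsum⟩ := H z (by omega)
    have hle := hasSum_le (fun k => ?_) hs.hasSum (hμ.neg.mean.neg.sub hsum)
    · have h := (Equiv.neg ℤ).hasSum_iff.2 hs.hasSum
      refine ⟨_, ?_, h.congr_fun fun k => ?_⟩
      · linarith
      · simp only [Function.comp, Equiv.neg_apply, neg_neg, sub_neg_eq_add]
        rw [hz, add_right_comm]
    · have h1 := linCorrected_le_add_exp hθ (z - k)
      have h2 : linCorrected θ z = z + 1 - Real.exp (-θ * z) := if_pos hz0
      rw [h2]
      push_cast at h1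
      have := mul_le_mul_of_nonneg_left (sub_le_sub_right h1 (z + 1 - Real.exp (-θ * z)))
        (hμ.neg.nonneg k)
      refine this.trans (le_of_eq ?_)
      ring

variable {m : ℕ} {ν : (Fin m → ℤ) → ℝ}

theorem AxisLaw.hasSum_mul_prod (hν : AxisLaw ν) (L : Fin m → ℤ → ℝ) (u : Fin m → ℤ)
    (d : Fin m → ℝ)
    (hd : ∀ i, HasSum (fun k => axisLaw ν i k * (L i (u i + k) - L i (u i))) (d i)) :
    HasSum (fun w => ν w * ∏ i, L i (u i + w i))
      (∏ i, L i (u i) + ∑ i, (∏ j ∈ Finset.univ.erase i, L j (u j)) * d i) := by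
  have h1 : ∀ i, HasSum (fun w => axisWeight ν i w *
      (∏ j, L j (u j + w j) - ∏ j, L j (u j)))
      ((∏ j ∈ Finset.univ.erase i, L j (u j)) * d i) := by
    intro i
    have h := hd i
    have h' := (hν.hasSum_axisLaw_iff i (fun w => L i (u i + w i) - L i (u i)) (d i)).1
      (by simpa only [Pi.single_eq_same] using h)
    refine (h'.mul_left (∏ j ∈ Finset.univ.erase i, L j (u j))).congr_fun fun w => ?_
    by_cases hw : axisWeight ν i w = 0
    · simp [hw]
    · rw [← Finset.mul_prod_erase Finset.univ _ (Finset.mem_univ i),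
        ← Finset.mul_prod_erase Finset.univ (fun j => L j (u j)) (Finset.mem_univ i)]
      have : ∏ j ∈ Finset.univ.erase i, L j (u j + w j)
          = ∏ j ∈ Finset.univ.erase i, L j (u j) := by
        refine Finset.prod_congr rfl fun j hj => ?_
        rw [hν.eq_single_of_axisWeight hw, Pi.single_eq_of_ne (Finset.ne_of_mem_erase hj),
          add_zero]
      rw [this]
      ring
  have h2 := hasSum_sum (s := Finset.univ) fun i (_ : i ∈ Finset.univ) => h1 i
  have h3 := (hν.hasSum.mul_right (∏ i, L i (u i))).add h2
  rw [one_mul] at h3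
  refine h3.congr_fun fun w => ?_
  have := hν.mul_eq_sum (fun w => ∏ j, L j (u j + w j) - ∏ j, L j (u j)) (by simp) w
  rw [← this]
  ring

theorem AxisLaw.mean_axisLaw (hν : AxisLaw ν) (i : Fin m) :
    HasSum (fun k : ℤ => axisLaw ν i k * (k : ℝ)) 0 := by
  obtain ⟨θ, hμ⟩ := hν.centeredLaw i
  exact hμ.mean

theorem AxisLaw.hasSum_mul_prod_coord (hν : AxisLaw ν) (u : Fin m → ℤ) :
    HasSum (fun w => ν w * ∏ i, ((u + w) i : ℝ)) (∏ i, (u i : ℝ)) := by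
  have := hν.hasSum_mul_prod (fun _ k => (k : ℝ)) u 0 (fun i =>
    (hν.mean_axisLaw i).congr_fun fun k => by push_cast; ring)
  simpa using this

/-- The product of the coordinates on the positive orthant, extended by zero. -/
noncomputable def orthantProd (u : Fin m → ℤ) : ℝ≥0∞ :=
  if u ∈ (posAll : Set (Fin m → ℤ)) then ENNReal.ofReal (∏ i, (u i : ℝ)) else 0

theorem AxisLaw.exists_superharmonic (hν : AxisLaw ν) :
    ∃ H : (Fin m → ℤ) → ℝ≥0∞, (∀ u, H u ≠ ⊤) ∧ orthantProd ≤ H ∧ killedOp ν posAll H ≤ H := by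
  choose θ hμ using hν.centeredLaw
  choose L hL0 hL1 hL2 using fun i => (hμ i).exists_superharmonic
  refine ⟨fun u => ENNReal.ofReal (∏ i, L i (u i)), fun u => ENNReal.ofReal_ne_top, fun u => ?_,
    fun u => ?_⟩
  · unfold orthantProd
    split_ifs with hu
    · refine ENNReal.ofReal_le_ofReal (Finset.prod_le_prod (fun i _ => ?_) fun i _ =>
        hL1 i (u i) (hu i))
      exact_mod_cast (hu i).le
    · exact zero_le
  · by_cases hu : u ∈ (posAll : Set (Fin m → ℤ))
    · choose d hd hsum using fun i => hL2 i (u i) (hu i)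
      have h := hν.hasSum_mul_prod L u d hsum
      have hle : ∏ i, L i (u i) + ∑ i, (∏ j ∈ Finset.univ.erase i, L j (u j)) * d i
          ≤ ∏ i, L i (u i) := by
        have : ∑ i, (∏ j ∈ Finset.univ.erase i, L j (u j)) * d i ≤ 0 :=
          Finset.sum_nonpos fun i _ => mul_nonpos_of_nonneg_of_nonpos
            (Finset.prod_nonneg fun j _ => hL0 j _) (hd i)
        linarith
      rw [killedOp_of_mem _ hu]
      refine le_trans ?_ (ENNReal.ofReal_le_ofReal hle)
      have hnn : ∀ w, 0 ≤ ν w * ∏ i, L i (u i + w i) := fun w =>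
        mul_nonneg (hν.nonneg w) (Finset.prod_nonneg fun j _ => hL0 j _)
      rw [← h.tsum_eq, ENNReal.ofReal_tsum_of_nonneg hnn h.summable]
      refine ENNReal.tsum_le_tsum fun w => ?_
      rw [ENNReal.ofReal_mul (hν.nonneg w)]
      refine mul_le_mul_right ?_ _
      split_ifs
      · rfl
      · exact zero_le
    · rw [killedOp_of_notMem _ hu]; exact zero_le

/-- The expected loss of the product of the coordinates when jumping out of the orthant. -/
noncomputable def exitLoss (ν : (Fin m → ℤ) → ℝ) (u : Fin m → ℤ) : ℝ≥0∞ :=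
  if u ∈ (posAll : Set (Fin m → ℤ)) then
    ∑' w, (if u + w ∈ (posAll : Set (Fin m → ℤ)) then 0
      else ENNReal.ofReal (-(ν w * ∏ i, ((u + w) i : ℝ)))) else 0

theorem AxisLaw.mul_prod_nonpos (hν : AxisLaw ν) {u w : Fin m → ℤ}
    (hu : u ∈ (posAll : Set (Fin m → ℤ))) (hw : u + w ∉ (posAll : Set (Fin m → ℤ))) :
    ν w * ∏ i, ((u + w) i : ℝ) ≤ 0 := by
  by_cases h : ν w = 0
  · rw [h, zero_mul]
  obtain ⟨i, hi⟩ : ∃ i, (u + w) i ≤ 0 := by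
    by_contra! h'
    exact hw h'
  have hui := hu i
  have hwi : w i ≠ 0 := by
    rw [Pi.add_apply] at hi; omega
  refine mul_nonpos_of_nonneg_of_nonpos (hν.nonneg w) ?_
  rw [← Finset.mul_prod_erase Finset.univ _ (Finset.mem_univ i)]
  refine mul_nonpos_of_nonpos_of_nonneg (by exact_mod_cast hi)
    (Finset.prod_nonneg fun j hj => ?_)
  have hwj : w j = 0 := by
    rw [hν.eq_single h hwi, Pi.single_eq_of_ne (Finset.ne_of_mem_erase hj)]
  rw [Pi.add_apply, hwj, add_zero]
  exact_mod_cast (hu j).le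

theorem tsum_ofReal_eq_add_tsum_ofReal_neg {ι : Type*} {f : ι → ℝ} {s : ℝ} (hf : HasSum f s)
    (hs : 0 ≤ s) : ∑' w, ENNReal.ofReal (f w) = ENNReal.ofReal s + ∑' w, ENNReal.ofReal (-f w) := by
  have hp : Summable fun w => max (f w) 0 :=
    hf.summable.abs.of_nonneg_of_le (fun w => le_max_right _ _)
      (fun w => max_le (le_abs_self _) (abs_nonneg _))
  have hn : Summable fun w => max (-f w) 0 :=
    hf.summable.abs.of_nonneg_of_le (fun w => le_max_right _ _)
      (fun w => max_le (neg_le_abs _) (abs_nonneg _))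
  have e : ∀ x : ℝ, ENNReal.ofReal x = ENNReal.ofReal (max x 0) := fun x => by
    rcases le_total x 0 with h | h
    · rw [max_eq_right h, ENNReal.ofReal_zero, ENNReal.ofReal_of_nonpos h]
    · rw [max_eq_left h]
  rw [tsum_congr fun w => e (f w), tsum_congr fun w => e (-f w),
    ← ENNReal.ofReal_tsum_of_nonneg (fun w => le_max_right _ _) hp,
    ← ENNReal.ofReal_tsum_of_nonneg (fun w => le_max_right _ _) hn,
    ← ENNReal.ofReal_add hs (tsum_nonneg fun w => le_max_right _ _)]
  have h : HasSum (fun w => max (f w) 0) (s + ∑' w, max (-f w) 0) :=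
    (hf.add hn.hasSum).congr_fun fun w => by
      rcases le_total (f w) 0 with h | h
      · rw [max_eq_right h, max_eq_left (by linarith)]; ring
      · rw [max_eq_left h, max_eq_right (by linarith)]; ring
  rw [h.tsum_eq]

theorem AxisLaw.killedOp_orthantProd (hν : AxisLaw ν) :
    killedOp ν posAll orthantProd = orthantProd + exitLoss ν := by
  funext u
  rw [Pi.add_apply]
  by_cases hu : u ∈ (posAll : Set (Fin m → ℤ))
  · rw [killedOp_of_mem _ hu, orthantProd, exitLoss, if_pos hu, if_pos hu]
    have hF : 0 ≤ ∏ i, (u i : ℝ) := Finset.prod_nonneg fun i _ => by exact_mod_cast (hu i).le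
    have h := tsum_ofReal_eq_add_tsum_ofReal_neg (hν.hasSum_mul_prod_coord u) hF
    refine Eq.trans (tsum_congr fun w => ?_) (h.trans ?_)
    · split_ifs with hw
      · rw [orthantProd, if_pos hw, ENNReal.ofReal_mul (hν.nonneg w)]
      · rw [mul_zero, ENNReal.ofReal_of_nonpos (hν.mul_prod_nonpos hu hw)]
    · congr 1
      refine tsum_congr fun w => ?_
      split_ifs with hw
      · refine ENNReal.ofReal_of_nonpos (neg_nonpos.2 (mul_nonneg (hν.nonneg w) ?_))
        exact Finset.prod_nonneg fun i _ => by exact_mod_cast (hw i).le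
      · rfl
  · rw [killedOp_of_notMem _ hu, orthantProd, exitLoss, if_neg hu, if_neg hu, add_zero]

/-- The candidate harmonic function, in `[0, ∞]`. -/
noncomputable def prodHarmonic (ν : (Fin m → ℤ) → ℝ) (u : Fin m → ℤ) : ℝ≥0∞ :=
  orthantProd u + ∑' n, (killedOp ν posAll)^[n] (exitLoss ν) u

theorem killedOp_prodHarmonic (hν : AxisLaw ν) :
    killedOp ν posAll (prodHarmonic ν) = prodHarmonic ν := by
  have e : prodHarmonic ν = orthantProd +
      fun u => ∑' n, (killedOp ν posAll)^[n] (exitLoss ν) u := rfl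
  rw [e, killedOp_add, killedOp_tsum, hν.killedOp_orthantProd, add_assoc]
  congr 1
  funext u
  rw [Pi.add_apply, tsum_eq_zero_add' (f := fun n => (killedOp ν posAll)^[n] (exitLoss ν) u)
    ENNReal.summable]
  simp only [Function.iterate_zero, id_eq, Function.iterate_succ_apply']

theorem prodHarmonic_ne_top (hν : AxisLaw ν) (u : Fin m → ℤ) : prodHarmonic ν u ≠ ⊤ := by
  obtain ⟨H, hfin, hle, hsup⟩ := hν.exists_superharmonic
  have h1 : ∀ N, (killedOp ν posAll)^[N] orthantProd
      = orthantProd + fun u => ∑ n ∈ Finset.range N, (killedOp ν posAll)^[n] (exitLoss ν) u := by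
    intro N
    induction N with
    | zero => funext u; simp
    | succ N ih =>
      rw [Function.iterate_succ_apply, hν.killedOp_orthantProd, iterate_killedOp_add, ih]
      funext u
      simp only [Pi.add_apply]
      rw [Finset.sum_range_succ, add_assoc]
  have h2 : ∀ N, (killedOp ν posAll)^[N] H ≤ H := by
    intro N
    induction N with
    | zero => exact le_rfl
    | succ N ih =>
      rw [Function.iterate_succ_apply']
      exact (killedOp_mono ih).trans hsup
  refine ne_top_of_le_ne_top (hfin u) ?_
  rw [prodHarmonic, ENNReal.tsum_eq_iSup_nat, ENNReal.add_iSup]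
  refine iSup_le fun N => ?_
  have := ((killedOp_mono.iterate N hle).trans (h2 N)) u
  rwa [h1] at this

end ProductHarmonic

section KilledKernel

open scoped ENNReal

variable {V : Type*} [AddCommGroup V] {ν : V → ℝ} {A : Set V}

theorem kern_succ (n : ℕ) (x y : V) :
    kern ν A (n + 1) x y = ∑' z : V, (if x ∈ A then ν (z - x) else 0) * kern ν A n z y :=
  rfl

theorem kern_of_notMem_left (n : ℕ) {x : V} (hx : x ∉ A) (y : V) : kern ν A n x y = 0 := by
  cases n with
  | zero => simp [kern, hx]
  | succ n => simp [kern_succ, hx]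

theorem kern_of_notMem_right (n : ℕ) (x : V) {y : V} (hy : y ∉ A) : kern ν A n x y = 0 := by
  induction n generalizing x with
  | zero =>
    refine if_neg ?_
    rintro ⟨rfl, hx⟩
    exact hy hx
  | succ n ih => simp [kern_succ, ih]

theorem summable_step (hs : Summable ν) (x : V) :
    Summable fun z => if x ∈ A then ν (z - x) else 0 := by
  by_cases hx : x ∈ A
  · simp only [if_pos hx]
    exact (Equiv.subRight x).summable_iff.2 hs
  · simpa only [if_neg hx] using summable_zero

theorem tsum_step_le (hs : HasSum ν 1) (x : V) :
    ∑' z, (if x ∈ A then ν (z - x) else 0) ≤ 1 := by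
  by_cases hx : x ∈ A
  · simp only [if_pos hx]
    exact ((Equiv.subRight x).hasSum_iff.2 hs).tsum_eq.le
  · simp [hx]

theorem kern_nonneg (hν : ∀ w, 0 ≤ ν w) (n : ℕ) (x y : V) : 0 ≤ kern ν A n x y := by
  induction n generalizing x with
  | zero => unfold kern; split_ifs <;> norm_num
  | succ n ih =>
    refine tsum_nonneg fun z => mul_nonneg ?_ (ih z)
    split_ifs
    · exact hν _
    · exact le_rfl

theorem step_nonneg (hν : ∀ w, 0 ≤ ν w) (x z : V) : 0 ≤ if x ∈ A then ν (z - x) else 0 := by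
  split_ifs
  · exact hν _
  · exact le_rfl

theorem kern_le_one (hν : ∀ w, 0 ≤ ν w) (hs : HasSum ν 1) (n : ℕ) (x y : V) :
    kern ν A n x y ≤ 1 := by
  induction n generalizing x with
  | zero => unfold kern; split_ifs <;> norm_num
  | succ n ih =>
    have hle : ∀ z, (if x ∈ A then ν (z - x) else 0) * kern ν A n z y
        ≤ if x ∈ A then ν (z - x) else 0 := fun z =>
      mul_le_of_le_one_right (step_nonneg hν x z) (ih z)
    refine le_trans (Summable.tsum_le_tsum hle ?_ (summable_step hs.summable x))
      (tsum_step_le hs x)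
    exact (summable_step hs.summable x).of_nonneg_of_le
      (fun z => mul_nonneg (step_nonneg hν x z) (kern_nonneg hν n z y)) hle

theorem ofReal_kern_succ (hν : ∀ w, 0 ≤ ν w) (hs : HasSum ν 1) (n : ℕ) {x : V} (hx : x ∈ A)
    (y : V) : ENNReal.ofReal (kern ν A (n + 1) x y)
      = ∑' w, ENNReal.ofReal (ν w) * ENNReal.ofReal (kern ν A n (x + w) y) := by
  have h0 : ∀ z, 0 ≤ (if x ∈ A then ν (z - x) else 0) * kern ν A n z y := fun z =>
    mul_nonneg (step_nonneg hν x z) (kern_nonneg hν n z y)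
  rw [kern_succ, ENNReal.ofReal_tsum_of_nonneg h0 ((summable_step hs.summable x).of_nonneg_of_le h0
    fun z => mul_le_of_le_one_right (step_nonneg hν x z) (kern_le_one hν hs n z y)),
    ← (Equiv.addLeft x).tsum_eq]
  refine tsum_congr fun w => ?_
  rw [Equiv.coe_addLeft, if_pos hx, add_sub_cancel_left, ENNReal.ofReal_mul (hν w)]

theorem iterate_killedOp_eq_tsum_kern (hν : ∀ w, 0 ≤ ν w) (hs : HasSum ν 1) {r : V → ℝ≥0∞}
    (hr : ∀ x ∉ A, r x = 0) (n : ℕ) (x : V) :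
    (killedOp ν A)^[n] r x = ∑' z, ENNReal.ofReal (kern ν A n x z) * r z := by
  induction n generalizing x with
  | zero =>
    rw [tsum_eq_single x]
    · by_cases hx : x ∈ A
      · simp [kern, hx]
      · simp [hr x hx]
    · intro z hz
      simp [kern, hz.symm]
  | succ n ih =>
    rw [Function.iterate_succ_apply']
    by_cases hx : x ∈ A
    · rw [killedOp_of_mem _ hx]
      simp only [ofReal_kern_succ hν hs n hx, ← ENNReal.tsum_mul_right]
      rw [ENNReal.tsum_comm]
      refine tsum_congr fun w => ?_
      simp only [mul_assoc]
      rw [ENNReal.tsum_mul_left]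
      congr 1
      split_ifs with hw
      · exact ih _
      · simp [kern_of_notMem_left n hw]
    · simp [killedOp_of_notMem _ hx, kern_of_notMem_left (n + 1) hx]

end KilledKernel

section Uniqueness

open scoped ENNReal

variable {m : ℕ} {ν : (Fin m → ℤ) → ℝ}

theorem exitLoss_of_notMem {u : Fin m → ℤ} (hu : u ∉ (posAll : Set (Fin m → ℤ))) :
    exitLoss ν u = 0 :=
  if_neg hu

theorem AxisLaw.tsum_iterate_exitLoss_ne_top (hν : AxisLaw ν) (u : Fin m → ℤ) :
    ∑' n, (killedOp ν posAll)^[n] (exitLoss ν) u ≠ ⊤ :=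
  ne_top_of_le_ne_top (prodHarmonic_ne_top hν u) le_add_self

theorem AxisLaw.exitLoss_ne_top (hν : AxisLaw ν) (u : Fin m → ℤ) : exitLoss ν u ≠ ⊤ :=
  ENNReal.ne_top_of_tsum_ne_top (hν.tsum_iterate_exitLoss_ne_top u) 0

theorem AxisLaw.tsum_exit_mul_prod (hν : AxisLaw ν) {z : Fin m → ℤ}
    (hz : z ∈ (posAll : Set (Fin m → ℤ))) :
    ∑' y : Fin m → ℤ, (if y ∉ (posAll : Set (Fin m → ℤ)) ∧ y ∈ Set.univ then ν (y - z) else 0) *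
      ∏ i, (y i : ℝ) = -(exitLoss ν z).toReal := by
  rw [exitLoss, if_pos hz, ENNReal.tsum_toReal_eq, ← tsum_neg, ← (Equiv.addLeft z).tsum_eq]
  · refine tsum_congr fun w => ?_
    simp only [Equiv.coe_addLeft, add_sub_cancel_left, Set.mem_univ, and_true]
    by_cases hw : z + w ∈ (posAll : Set (Fin m → ℤ))
    · simp [hw]
    · rw [if_pos hw, if_neg hw, ENNReal.toReal_ofReal, neg_neg]
      exact neg_nonneg.2 (hν.mul_prod_nonpos hz hw)
  · intro w
    split_ifs
    · exact ENNReal.zero_ne_top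
    · exact ENNReal.ofReal_ne_top

theorem AxisLaw.exitExp_prod (hν : AxisLaw ν) (u : Fin m → ℤ) :
    exitExp ν posAll Set.univ (fun y => ∏ i, (y i : ℝ)) u
      = -(∑' n, (killedOp ν posAll)^[n] (exitLoss ν) u).toReal := by
  have hfin := hν.tsum_iterate_exitLoss_ne_top u
  rw [exitExp, ENNReal.tsum_toReal_eq fun n => ENNReal.ne_top_of_tsum_ne_top hfin n, ← tsum_neg]
  refine tsum_congr fun n => ?_
  rw [iterate_killedOp_eq_tsum_kern hν.nonneg hν.hasSum (fun x hx => exitLoss_of_notMem hx) n u,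
    ENNReal.tsum_toReal_eq fun z =>
      ENNReal.mul_ne_top ENNReal.ofReal_ne_top (hν.exitLoss_ne_top z), ← tsum_neg]
  refine tsum_congr fun z => ?_
  rw [ENNReal.toReal_mul, ENNReal.toReal_ofReal (kern_nonneg hν.nonneg n u z)]
  by_cases hz : z ∈ (posAll : Set (Fin m → ℤ))
  · rw [← mul_neg, ← hν.tsum_exit_mul_prod hz]
    congr!
  · rw [kern_of_notMem_right n u hz, zero_mul, zero_mul, neg_zero]

theorem prod_coord_pos {u : Fin m → ℤ} (hu : u ∈ (posAll : Set (Fin m → ℤ))) :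
    0 < ∏ i, (u i : ℝ) :=
  Finset.prod_pos fun i _ => by exact_mod_cast hu i

theorem AxisLaw.fProd_eq (hν : AxisLaw ν) {u : Fin m → ℤ}
    (hu : u ∈ (posAll : Set (Fin m → ℤ))) : fProd ν u = (prodHarmonic ν u).toReal := by
  have h1 : orthantProd u = ENNReal.ofReal (∏ i, (u i : ℝ)) := if_pos hu
  have h2 := hν.exitExp_prod u
  rw [prodHarmonic, h1, ENNReal.toReal_add ENNReal.ofReal_ne_top (hν.tsum_iterate_exitLoss_ne_top u),
    ENNReal.toReal_ofReal (prod_coord_pos hu).le, ← sub_neg_eq_add, ← h2]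
  rfl

theorem AxisLaw.fProd_pos (hν : AxisLaw ν) {u : Fin m → ℤ}
    (hu : u ∈ (posAll : Set (Fin m → ℤ))) : 0 < fProd ν u := by
  rw [hν.fProd_eq hu]
  refine ENNReal.toReal_pos (fun h => ?_) (prodHarmonic_ne_top hν u)
  have h1 : orthantProd u = ENNReal.ofReal (∏ i, (u i : ℝ)) := if_pos hu
  have h2 : orthantProd u = 0 := (add_eq_zero.1 h).1
  rw [h1, ENNReal.ofReal_eq_zero] at h2
  exact h2.not_gt (prod_coord_pos hu)

theorem AxisLaw.harmOn_fProd (hν : AxisLaw ν) : HarmOn ν posAll (fProd ν) := by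
  intro u hu
  refine (hν.fProd_eq hu).trans ((harmOn_toReal_of_killedOp_eq hν.nonneg (prodHarmonic_ne_top hν)
    (killedOp_prodHarmonic hν) u hu).trans ?_)
  refine tsum_congr fun y => ?_
  split_ifs with hy
  · rw [hν.fProd_eq hy]
  · rfl

theorem HarmOn.const_mul {V : Type*} [AddCommGroup V] {ν : V → ℝ} {A : Set V} {g : V → ℝ}
    (hg : HarmOn ν A g) (c : ℝ) : HarmOn ν A (fun x => c * g x) := by
  intro x hx
  beta_reduce
  rw [hg x hx, ← tsum_mul_left]
  refine tsum_congr fun y => ?_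
  split_ifs
  · ring
  · rw [mul_zero]

theorem AxisLaw.div_update_eq (hν : AxisLaw ν) {f g : (Fin m → ℤ) → ℝ}
    (hf : ∀ x ∈ (posAll : Set (Fin m → ℤ)), 0 < f x) (hfh : HarmOn ν posAll f)
    (hg : ∀ x ∈ (posAll : Set (Fin m → ℤ)), 0 < g x) (hgh : HarmOn ν posAll g)
    {u : Fin m → ℤ} (hu : u ∈ (posAll : Set (Fin m → ℤ))) (i : Fin m) {x : ℤ} (hx : 0 < x) :
    g (Function.update u i x) / f (Function.update u i x) = g u / f u := by
  have hmem : ∀ y : ℤ, 0 < y → Function.update u i y ∈ (posAll : Set (Fin m → ℤ)) := by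
    intro y hy j
    by_cases hj : j = i
    · subst hj; simpa using hy
    · simpa [Function.update_of_ne hj] using hu j
  obtain ⟨θ, hμ⟩ := hν.centeredLaw i
  obtain ⟨c, hc⟩ := HalfLineHarmonic.proportional hμ
    (fun x y hx hy => hν.reflTransGen i x y hx hy)
    (hν.halfLineHarmonic hg hgh i hu) (hν.halfLineHarmonic hf hfh i hu) (by
      rw [Set.indicator_of_mem (hmem 1 one_pos)]
      exact hf _ (hmem 1 one_pos))
  have key : ∀ y : ℤ, 0 < y → g (Function.update u i y) / f (Function.update u i y) = c := by
    intro y hy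
    have h := hc y
    rw [Set.indicator_of_mem (hmem y hy), Set.indicator_of_mem (hmem y hy)] at h
    rw [h, mul_div_cancel_right₀ _ (hf _ (hmem y hy)).ne']
  have h := key (u i) (hu i)
  rw [Function.update_eq_self] at h
  rw [key x hx, h]

theorem AxisLaw.div_eq_div_one (hν : AxisLaw ν) {f g : (Fin m → ℤ) → ℝ}
    (hf : ∀ x ∈ (posAll : Set (Fin m → ℤ)), 0 < f x) (hfh : HarmOn ν posAll f)
    (hg : ∀ x ∈ (posAll : Set (Fin m → ℤ)), 0 < g x) (hgh : HarmOn ν posAll g)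
    {u : Fin m → ℤ} (hu : u ∈ (posAll : Set (Fin m → ℤ))) : g u / f u = g 1 / f 1 := by
  have key : ∀ s : Finset (Fin m), g (s.piecewise 1 u) / f (s.piecewise 1 u) = g u / f u := by
    intro s
    induction s using Finset.induction_on with
    | empty => simp
    | insert i s _ ih =>
      rw [Finset.piecewise_insert, Pi.one_apply, hν.div_update_eq hf hfh hg hgh _ i one_pos, ih]
      intro j
      by_cases hj : j ∈ s
      · simp [hj]
      · simpa [hj] using hu j
  rw [← key Finset.univ, Finset.piecewise_univ]

end Uniqueness

theorem statement19 {m : ℕ} (ν : (Fin m → ℤ) → ℝ)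
    (hnn : ∀ u, 0 ≤ ν u) (hsum : HasSum ν 1)
    (hC1 : Irred ν {u : Fin m → ℤ | ∀ i, 0 < u i})
    (hC2 : ∃ ε : ℝ, 0 < ε ∧ ∀ α : Fin m → ℝ, rnorm α < ε →
      Summable (fun u : Fin m → ℤ => ν u * Real.exp (∑ i, α i * (u i : ℝ))))
    (hC3 : ∀ i : Fin m, HasSum (fun u : Fin m → ℤ => ν u * (u i : ℝ)) 0)
    (hC4 : ∀ u : Fin m → ℤ, (∃ i j : Fin m, i ≠ j ∧ u i ≠ 0 ∧ u j ≠ 0) → ν u = 0) :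
    -- every positive multiple of `f` is a positive harmonic function of `P₊`
    (∀ c : ℝ, 0 < c →
      (∀ u : Fin m → ℤ, (∀ i, 0 < u i) → 0 < c * fProd ν u) ∧
      HarmOn ν {u : Fin m → ℤ | ∀ i, 0 < u i} (fun u => c * fProd ν u)) ∧
    -- and conversely every positive harmonic function of `P₊` is such a multiple
    (∀ g : (Fin m → ℤ) → ℝ, (∀ u : Fin m → ℤ, (∀ i, 0 < u i) → 0 < g u) →
      HarmOn ν {u : Fin m → ℤ | ∀ i, 0 < u i} g →
      ∃ c : ℝ, 0 < c ∧ ∀ u : Fin m → ℤ, (∀ i, 0 < u i) → g u = c * fProd ν u) := by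
  have hν : AxisLaw ν := ⟨hnn, hsum, hC1, hC2, hC3, hC4⟩
  refine ⟨fun c hc => ⟨fun u hu => mul_pos hc (hν.fProd_pos hu), hν.harmOn_fProd.const_mul c⟩,
    fun g hg hgh => ?_⟩
  have h1 : (1 : Fin m → ℤ) ∈ (posAll : Set (Fin m → ℤ)) := fun _ => one_pos
  refine ⟨g 1 / fProd ν 1, div_pos (hg 1 h1) (hν.fProd_pos h1), fun u hu => ?_⟩
  rw [← hν.div_eq_div_one (fun x hx => hν.fProd_pos hx) hν.harmOn_fProd hg hgh hu,
    div_mul_cancel₀ _ (hν.fProd_pos hu).ne']
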